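/- arXiv:1609.07315 — 3 statements merged into one kernel-verified Lean document; each statement's English description precedes it below -/
import Mathlib

section
/- Let μ₀ be the uniform probability measure on the symmetric group S_n of all permutations of {1,…,n}. For every subset A ⊆ S_n with μ₀(A) ≥ 1/2 and every t ≥ 0, one has μ₀(A_t) ≥ 1 − 2·exp(−t²/(64n)), where A_t = {σ ∈ S_n : d_H(σ,A) ≤ t} and d_H(σ,A) = min_{τ∈A} d_H(σ,τ). -/
attribute [local instance] Classical.propDecidable

noncomputable section

/-- Hamming distance on permutations, as a real number. -/
noncomputable def dH {n : ℕ} (σ τ : Equiv.Perm (Fin n)) : ℝ :=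
  ((Finset.univ.filter fun i => σ i ≠ τ i).card : ℝ)

theorem dH_eq_hammingDist {n : ℕ} (σ τ : Equiv.Perm (Fin n)) :
    dH σ τ = hammingDist (⇑σ) (⇑τ) := by
  unfold dH hammingDist
  congr

theorem dH_triangle {n : ℕ} (σ τ υ : Equiv.Perm (Fin n)) : dH σ υ ≤ dH σ τ + dH τ υ := by
  simp only [dH_eq_hammingDist]
  exact_mod_cast hammingDist_triangle (⇑σ) (⇑τ) (⇑υ)

theorem dH_decomposeFin_symm_same {n : ℕ} (p : Fin (n + 1)) (σ τ : Equiv.Perm (Fin n)) :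
    dH (Equiv.Perm.decomposeFin.symm (p, σ)) (Equiv.Perm.decomposeFin.symm (p, τ)) ≤ dH σ τ := by
  unfold dH
  norm_cast
  refine (Finset.card_le_card (t := (Finset.univ.filter fun i => σ i ≠ τ i).map
    (Fin.succEmb n)) ?_).trans_eq (Finset.card_map _)
  intro i
  cases i using Fin.cases with
  | zero => simp
  | succ i => simp

theorem dH_decomposeFin_symm_le_three {n : ℕ} (p q : Fin (n + 1)) (σ : Equiv.Perm (Fin n)) :
    dH (Equiv.Perm.decomposeFin.symm (p, σ)) (Equiv.Perm.decomposeFin.symm (q, σ)) ≤ 3 := by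
  set ρ : Equiv.Perm (Fin (n + 1)) := Equiv.Perm.decomposeFin.symm (0, σ) with hρ
  have key : ∀ (r i : Fin (n + 1)),
      Equiv.Perm.decomposeFin.symm (r, σ) i = Equiv.swap 0 r (ρ i) := by
    intro r i
    cases i using Fin.cases <;> simp [hρ]
  have hsub : (Finset.univ.filter fun i => Equiv.Perm.decomposeFin.symm (p, σ) i ≠
      Equiv.Perm.decomposeFin.symm (q, σ) i) ⊆ ({ρ.symm 0, ρ.symm p, ρ.symm q} : Finset _) := by
    intro i hi
    by_contra hmem
    simp only [Finset.mem_insert, Finset.mem_singleton, not_or, Equiv.eq_symm_apply] at hmem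
    obtain ⟨h0, hp, hq⟩ := hmem
    simp only [Finset.mem_filter, key] at hi
    exact hi.2 (by rw [Equiv.swap_apply_of_ne_of_ne h0 hp, Equiv.swap_apply_of_ne_of_ne h0 hq])
  unfold dH
  exact_mod_cast (Finset.card_le_card hsub).trans Finset.card_le_three

/-- If `a` varies by a factor at most `exp x` and `a i * b i ≤ M`, then the product of the sums
of `a` and `b` is controlled. -/
theorem sum_mul_sum_le_of_le_exp_mul {ι : Type*} [Fintype ι] {a b : ι → ℝ} {M x : ℝ}
    (ha : ∀ i, 0 < a i) (hb : ∀ i, 0 < b i) (hab : ∀ i, a i * b i ≤ M)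
    (hx : ∀ i j, a i ≤ Real.exp x * a j) :
    (∑ i, a i) * ∑ i, b i ≤ (Fintype.card ι : ℝ) ^ 2 * (M * Real.exp (x ^ 2 / 2)) := by
  have pair : ∀ i j, a i * b j + a j * b i ≤ 2 * (M * Real.exp (x ^ 2 / 2)) := by
    intro i j
    have hM : 0 ≤ M := (mul_pos (ha i) (hb i)).le.trans (hab i)
    have quot : ∀ k l, a k * b l ≤ M * Real.exp (Real.log (a k) - Real.log (a l)) := by
      intro k l
      rw [Real.exp_sub, Real.exp_log (ha k), Real.exp_log (ha l), mul_div_assoc',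
        le_div_iff₀ (ha l)]
      nlinarith [hab l, ha k]
    have hlog : ∀ k l, Real.log (a k) - Real.log (a l) ≤ x := by
      intro k l
      have := Real.log_le_log (ha k) (hx k l)
      rw [Real.log_mul (Real.exp_pos x).ne' (ha l).ne', Real.log_exp] at this
      linarith
    set y := Real.log (a i) - Real.log (a j) with hy
    have h₁ := quot i j
    have h₂ := quot j i
    rw [← hy] at h₁
    rw [show Real.log (a j) - Real.log (a i) = -y by rw [hy]; ring] at h₂
    have hcosh := Real.cosh_le_exp_half_sq y
    rw [Real.cosh_eq] at hcosh
    have hyx : y ^ 2 ≤ x ^ 2 := by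
      have := hlog i j
      have := hlog j i
      exact sq_le_sq' (by linarith) (by linarith)
    have hexp : Real.exp (y ^ 2 / 2) ≤ Real.exp (x ^ 2 / 2) := by gcongr
    nlinarith
  have hswap : ∑ i, ∑ j, a j * b i = ∑ i, ∑ j, a i * b j := Finset.sum_comm
  have hsum := Finset.sum_le_sum fun i (_ : i ∈ Finset.univ) =>
    Finset.sum_le_sum fun j (_ : j ∈ Finset.univ) => pair i j
  simp only [Finset.sum_add_distrib, hswap, Finset.sum_const, Finset.card_univ,
    nsmul_eq_mul] at hsum
  rw [Finset.sum_mul_sum]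
  linarith

/-- Symmetrised Laplace transform bound for Lipschitz functions on the symmetric group. -/
theorem sum_exp_mul_sum_exp_neg_le (L : ℝ) (n : ℕ) (f : Equiv.Perm (Fin n) → ℝ) (hL : 0 ≤ L)
    (hf : ∀ σ τ, f σ - f τ ≤ L * dH σ τ) :
    (∑ σ, Real.exp (f σ)) * ∑ σ, Real.exp (-f σ) ≤
      (n.factorial : ℝ) ^ 2 * Real.exp (n * ((3 * L) ^ 2 / 2)) := by
  induction n with
  | zero => simp [← Real.exp_add]
  | succ n ih =>
    set g : Fin (n + 1) → Equiv.Perm (Fin n) → ℝ :=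
      fun p σ => f (Equiv.Perm.decomposeFin.symm (p, σ)) with hg
    have hsplit : ∀ F : Equiv.Perm (Fin (n + 1)) → ℝ,
        ∑ σ, F σ = ∑ p, ∑ σ, F (Equiv.Perm.decomposeFin.symm (p, σ)) := by
      intro F
      rw [← Fintype.sum_prod_type', Equiv.sum_comp]
    rw [hsplit, hsplit]
    have hstep := sum_mul_sum_le_of_le_exp_mul (x := 3 * L)
      (a := fun p => ∑ σ, Real.exp (g p σ)) (b := fun p => ∑ σ, Real.exp (-g p σ))
      (fun p => by positivity) (fun p => by positivity)
      (fun p => ih (g p) fun σ τ => (hf _ _).trans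
        (mul_le_mul_of_nonneg_left (dH_decomposeFin_symm_same p σ τ) hL)) ?_
    · refine hstep.trans_eq ?_
      rw [Fintype.card_fin, mul_assoc, ← Real.exp_add, Nat.factorial_succ]
      push_cast
      ring_nf
    · intro p q
      rw [Finset.mul_sum]
      refine Finset.sum_le_sum fun σ _ => ?_
      rw [← Real.exp_add, Real.exp_le_exp]
      have h₁ := hf (Equiv.Perm.decomposeFin.symm (p, σ)) (Equiv.Perm.decomposeFin.symm (q, σ))
      have h₂ := mul_le_mul_of_nonneg_left (dH_decomposeFin_symm_le_three p q σ) hL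
      simp only [hg]
      linarith

/-- Maurey's concentration inequality on the symmetric group. -/
theorem stmt0 {n : ℕ} (hn : 2 ≤ n) (A : Finset (Equiv.Perm (Fin n)))
    (hA : (1 : ℝ) / 2 ≤ (A.card : ℝ) / (n.factorial : ℝ)) (t : ℝ) (ht : 0 ≤ t) :
    1 - 2 * Real.exp (-(t ^ 2) / (64 * n)) ≤
      ((Finset.univ.filter fun σ : Equiv.Perm (Fin n) =>
          ∃ τ ∈ A, dH σ τ ≤ t).card : ℝ) / (n.factorial : ℝ) := by
  have hn0 : (0 : ℝ) < n := by exact_mod_cast (by omega : 0 < n)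
  have hfac : (0 : ℝ) < n.factorial := by exact_mod_cast n.factorial_pos
  rw [le_div_iff₀ hfac] at hA
  have hne : A.Nonempty := by
    rw [← Finset.card_pos, ← Nat.cast_pos (α := ℝ)]
    linarith
  set L : ℝ := t / (9 * n) with hLdef
  have hL : 0 ≤ L := by positivity
  set d : Equiv.Perm (Fin n) → ℝ := fun σ => A.inf' hne (dH σ) with hd
  have hlip : ∀ σ τ, L * d σ - L * d τ ≤ L * dH σ τ := by
    intro σ τ
    obtain ⟨υ, hυ, hmin⟩ := Finset.exists_mem_eq_inf' hne (dH τ)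
    have h₁ : d σ ≤ dH σ υ := Finset.inf'_le _ hυ
    have h₂ : d τ = dH τ υ := hmin
    rw [← mul_sub]
    exact mul_le_mul_of_nonneg_left (by linarith [dH_triangle σ τ υ]) hL
  have hmain := sum_exp_mul_sum_exp_neg_le L n (fun σ => L * d σ) hL hlip
  have hneg : (A.card : ℝ) ≤ ∑ σ, Real.exp (-(L * d σ)) := by
    have hle : ∀ σ ∈ A, (1 : ℝ) ≤ Real.exp (-(L * d σ)) := by
      intro σ hσ
      have h₁ : d σ ≤ dH σ σ := Finset.inf'_le _ hσ
      have h₂ : dH σ σ = 0 := by simp [dH]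
      rw [Real.one_le_exp_iff]
      nlinarith
    calc (A.card : ℝ) = ∑ σ ∈ A, (1 : ℝ) := by simp
      _ ≤ ∑ σ ∈ A, Real.exp (-(L * d σ)) := Finset.sum_le_sum hle
      _ ≤ _ := Finset.sum_le_univ_sum_of_nonneg fun σ => (Real.exp_pos _).le
  set good := Finset.univ.filter fun σ : Equiv.Perm (Fin n) => ∃ τ ∈ A, dH σ τ ≤ t with hgood
  have hpos : (goodᶜ.card : ℝ) * Real.exp (L * t) ≤ ∑ σ, Real.exp (L * d σ) := by
    have hle : ∀ σ ∈ goodᶜ, Real.exp (L * t) ≤ Real.exp (L * d σ) := by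
      intro σ hσ
      simp only [hgood, Finset.mem_compl, Finset.mem_filter, Finset.mem_univ, true_and, not_exists,
        not_and, not_le] at hσ
      have : t ≤ d σ := Finset.le_inf' _ _ fun τ hτ => (hσ τ hτ).le
      gcongr
    calc (goodᶜ.card : ℝ) * Real.exp (L * t) = ∑ σ ∈ goodᶜ, Real.exp (L * t) := by simp
      _ ≤ ∑ σ ∈ goodᶜ, Real.exp (L * d σ) := Finset.sum_le_sum hle
      _ ≤ _ := Finset.sum_le_univ_sum_of_nonneg fun σ => (Real.exp_pos _).le
  have hcard : (good.card : ℝ) + goodᶜ.card = n.factorial := by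
    rw [← Nat.cast_add, Finset.card_add_card_compl, Fintype.card_perm, Fintype.card_fin]
  have hprod : (goodᶜ.card : ℝ) * Real.exp (L * t) * (n.factorial / 2) ≤
      (n.factorial : ℝ) ^ 2 * Real.exp (n * ((3 * L) ^ 2 / 2)) :=
    (mul_le_mul hpos (by linarith) (by positivity) (by positivity)).trans hmain
  have hbad : (goodᶜ.card : ℝ) ≤
      2 * n.factorial * Real.exp (n * ((3 * L) ^ 2 / 2) - L * t) := by
    rw [Real.exp_sub, mul_div_assoc', le_div_iff₀ (Real.exp_pos _)]
    nlinarith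
  have hexp : Real.exp (n * ((3 * L) ^ 2 / 2) - L * t) ≤ Real.exp (-(t ^ 2) / (64 * n)) := by
    rw [Real.exp_le_exp]
    have : n * ((3 * L) ^ 2 / 2) - L * t = -(t ^ 2) / (18 * n) := by
      rw [hLdef]
      field_simp
      ring
    rw [this, neg_div, neg_div, neg_le_neg_iff]
    gcongr
    norm_num
  rw [le_div_iff₀ hfac]
  nlinarith

end
end

section
/- Let μ₀ be the uniform probability measure on S_n. For every nonempty subset A ⊆ S_n, ∑_{σ∈S_n} exp(f(σ,A)/16) μ₀(σ) ≤ 1/μ₀(A). -/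
attribute [local instance] Classical.propDecidable

noncomputable section

/-- Talagrand's convex-hull distance functional `f(σ, A)`. -/
noncomputable def fTal {n : ℕ} (A : Finset (Equiv.Perm (Fin n)))
    (σ : Equiv.Perm (Fin n)) : ℝ :=
  sInf {w | ∃ p : Equiv.Perm (Fin n) → ℝ,
    (∀ τ, 0 ≤ p τ) ∧ (∀ τ, τ ∉ A → p τ = 0) ∧ (∑ τ, p τ = 1) ∧
    w = ∑ j : Fin n, (∑ τ, p τ * (if σ j ≠ τ j then (1 : ℝ) else 0)) ^ 2}

section EntropyBounds

open Finset

lemma fenchel_mul_log (a : ℝ) {z : ℝ} (hz : 0 < z) : a * z - Real.exp a ≤ z * Real.log z - z := by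
  have h := Real.add_one_le_exp (a - Real.log z)
  rw [Real.exp_sub, Real.exp_log hz, le_div_iff₀ hz] at h
  linarith

lemma half_sq_le_mul_log {z : ℝ} (hz : 0 < z) (h1 : z ≤ 1) :
    (1 - z) ^ 2 / 2 ≤ z * Real.log z - z + 1 := by
  have hd : ∀ x : ℝ, 0 < x → HasDerivAt (fun x => x * Real.log x - x + 1 - (1 - x) ^ 2 / 2)
      (Real.log x + (1 - x)) x := by
    intro x hx
    have h := (((Real.hasDerivAt_mul_log hx.ne').sub (hasDerivAt_id x)).add_const 1).sub
      ((((hasDerivAt_id x).const_sub 1).pow 2).div_const 2)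
    refine h.congr_deriv ?_
    simp
    ring
  have hanti : AntitoneOn (fun x => x * Real.log x - x + 1 - (1 - x) ^ 2 / 2) (Set.Ioc 0 1) := by
    refine antitoneOn_of_deriv_nonpos (convex_Ioc 0 1)
      (fun x hx => (hd x hx.1).continuousAt.continuousWithinAt) ?_ ?_
    · intro x hx
      rw [interior_Ioc] at hx
      exact (hd x hx.1).differentiableAt.differentiableWithinAt
    · intro x hx
      rw [interior_Ioc] at hx
      rw [(hd x hx.1).deriv]
      linarith [Real.log_le_sub_one_of_pos hx.1]
  have h := hanti ⟨hz, h1⟩ ⟨one_pos, le_rfl⟩ h1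
  simp at h
  linarith

lemma sq_div_le_mul_log {z : ℝ} (h1 : 1 ≤ z) :
    (z - 1) ^ 2 / (2 * z) ≤ z * Real.log z - z + 1 := by
  have hz : 0 < z := by linarith
  have h := half_sq_le_mul_log (inv_pos.2 hz) (inv_le_one_of_one_le₀ h1)
  rw [Real.log_inv] at h
  have h2 := Real.add_one_le_exp (Real.log z)
  have e1 : (1 - z⁻¹) ^ 2 / 2 = (z - 1) ^ 2 / (2 * z) / z := by field_simp
  have hl := Real.one_sub_inv_le_log_of_pos hz
  have hb : 2 * (z - 1) / (z + 1) ≤ Real.log z := by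
    have := Real.le_log_one_add_of_nonneg (x := z - 1) (by linarith)
    have e : z - 1 + 2 = z + 1 := by ring
    have e' : 1 + (z - 1) = z := by ring
    rwa [e, e'] at this
  have h3 : z * (2 * (z - 1) / (z + 1)) ≤ z * Real.log z := mul_le_mul_of_nonneg_left hb hz.le
  have h4 : (z - 1) ^ 2 / (2 * z) ≤ z * (2 * (z - 1) / (z + 1)) - z + 1 := by
    have : z * (2 * (z - 1) / (z + 1)) - z + 1 = (z - 1) ^ 2 / (z + 1) := by field_simp; ring
    rw [this]
    exact div_le_div_of_nonneg_left (sq_nonneg _) (by linarith) (by linarith)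
  linarith

/-- A truncated quadratic lower bound for `z log z - z + 1`. -/
lemma huber_le_mul_log {z : ℝ} (hz : 0 < z) :
    3 / 4 * (min (z - 1) 1) ^ 2 + 3 / 2 * max (z - 2) 0 ≤ 2 * (z * Real.log z - z + 1) := by
  rcases le_total z 1 with h1 | h1
  · rw [min_eq_left (by linarith), max_eq_right (by linarith)]
    nlinarith [half_sq_le_mul_log hz h1, sq_nonneg (z - 1)]
  rcases le_total z 2 with h2 | h2
  · rw [min_eq_left (by linarith), max_eq_right (by linarith)]
    rcases le_total z (5 / 3) with h3 | h3
    · have hb : 2 * (z - 1) / (z + 1) ≤ Real.log z := by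
        have := Real.le_log_one_add_of_nonneg (x := z - 1) (by linarith)
        have e : z - 1 + 2 = z + 1 := by ring
        have e' : 1 + (z - 1) = z := by ring
        rwa [e, e'] at this
      have h4 : z * (2 * (z - 1) / (z + 1)) ≤ z * Real.log z := mul_le_mul_of_nonneg_left hb hz.le
      have h5 : z * (2 * (z - 1) / (z + 1)) - z + 1 = (z - 1) ^ 2 / (z + 1) := by field_simp; ring
      have h6 : (z - 1) ^ 2 / (8 / 3) ≤ (z - 1) ^ 2 / (z + 1) :=
        div_le_div_of_nonneg_left (sq_nonneg _) (by linarith) (by linarith)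
      linarith
    · have h4 := fenchel_mul_log (3 / 5) hz
      have h5 : Real.exp (3 / 5) ≤ 1.8225 := by
        have := Real.exp_bound' (x := 3 / 5) (by norm_num) (by norm_num) (n := 6) (by norm_num)
        refine this.trans ?_
        norm_num [Finset.sum_range_succ, Nat.factorial]
      nlinarith [mul_nonneg (sub_nonneg.2 h2) (sub_nonneg.2 h3)]
  · rw [min_eq_right (by linarith), max_eq_left (by linarith)]
    have h4 := fenchel_mul_log (3 / 4) hz
    have h5 : Real.exp (3 / 4) ≤ 2.125 := by
      have := Real.exp_bound' (x := 3 / 4) (by norm_num) (by norm_num) (n := 6) (by norm_num)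
      refine this.trans ?_
      norm_num [Finset.sum_range_succ, Nat.factorial]
    nlinarith

lemma huber_sub_le (a b : ℝ) (ha : 0 ≤ a) (hb : 0 ≤ b) :
    3 / 4 * (min |a - b| 1) ^ 2 + max (|a - b| - 1) 0 ≤
      3 / 4 * (min (a - 1) 1 - min (b - 1) 1) ^ 2 +
        (3 / 2 * max (a - 2) 0 + 3 / 2 * max (b - 2) 0) := by
  wlog h : b ≤ a generalizing a b
  · have := this b a hb ha (le_of_not_ge h)
    rw [abs_sub_comm a b]
    nlinarith
  rw [abs_of_nonneg (sub_nonneg.2 h)]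
  rcases le_total (a - 1) 1 with h1 | h1 <;> rcases le_total (b - 1) 1 with h2 | h2 <;>
  rcases le_total (a - b) 1 with h3 | h3 <;>
  simp only [h1, h2, h3, min_eq_left, min_eq_right,
    show a - 1 ≤ 1 → max (a - 2) 0 = 0 from fun h => max_eq_right (by linarith),
    show b - 1 ≤ 1 → max (b - 2) 0 = 0 from fun h => max_eq_right (by linarith),
    show 1 ≤ a - 1 → max (a - 2) 0 = a - 2 from fun h => max_eq_left (by linarith),
    show 1 ≤ b - 1 → max (b - 2) 0 = b - 2 from fun h => max_eq_left (by linarith),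
    show a - b ≤ 1 → max (a - b - 1) 0 = 0 from fun h => max_eq_right (by linarith),
    show 1 ≤ a - b → max (a - b - 1) 0 = a - b - 1 from fun h => max_eq_left (by linarith)]
  · nlinarith
  · nlinarith
  · obtain rfl : a = 2 := by linarith
    obtain rfl : b = 2 := by linarith
    norm_num
  · linarith
  · nlinarith [mul_nonneg (sub_nonneg.2 h1) (sub_nonneg.2 h3)]
  · nlinarith [sq_nonneg (2 - b - 2/3), mul_nonneg (sub_nonneg.2 h1) (sub_nonneg.2 h3),
      sq_nonneg (2 - b - 1)]
  · nlinarith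
  · nlinarith

lemma sum_sum_sub_sq_le {ι : Type*} (V : Finset ι) (f : ι → ℝ) (c : ℝ) :
    ∑ i ∈ V, ∑ j ∈ V, (f i - f j) ^ 2 ≤ 2 * #V * ∑ i ∈ V, (f i - c) ^ 2 := by
  have e : ∀ i j, (f i - f j) ^ 2 =
      (f i - c) ^ 2 + (f j - c) ^ 2 - 2 * ((f i - c) * (f j - c)) := by intros; ring
  simp only [e, sum_sub_distrib, sum_add_distrib, ← mul_sum, sum_const, nsmul_eq_mul, ← sum_mul]
  nlinarith [sq_nonneg (∑ i ∈ V, (f i - c))]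

lemma sum_huber_le {ι : Type*} (V : Finset ι) (z : ι → ℝ) (hz : ∀ i ∈ V, 0 < z i)
    (hs : ∑ i ∈ V, z i = #V) :
    ∑ i ∈ V, ∑ j ∈ V, (3 / 4 * (min |z i - z j| 1) ^ 2 + max (|z i - z j| - 1) 0) ≤
      4 * #V * ∑ i ∈ V, z i * Real.log (z i) := by
  have h1 : ∑ i ∈ V, ∑ j ∈ V, (3 / 4 * (min |z i - z j| 1) ^ 2 + max (|z i - z j| - 1) 0) ≤
      ∑ i ∈ V, ∑ j ∈ V, (3 / 4 * (min (z i - 1) 1 - min (z j - 1) 1) ^ 2 +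
        (3 / 2 * max (z i - 2) 0 + 3 / 2 * max (z j - 2) 0)) :=
    sum_le_sum fun i hi => sum_le_sum fun j hj =>
      huber_sub_le _ _ (hz i hi).le (hz j hj).le
  have h2 := sum_sum_sub_sq_le V (fun i => min (z i - 1) 1) 0
  have h3 : ∑ i ∈ V, (3 / 4 * (min (z i - 1) 1) ^ 2 + 3 / 2 * max (z i - 2) 0) ≤
      ∑ i ∈ V, 2 * (z i * Real.log (z i) - z i + 1) :=
    sum_le_sum fun i hi => huber_le_mul_log (hz i hi)
  simp only [sum_add_distrib, ← mul_sum, sum_const, nsmul_eq_mul, sum_sub_distrib, hs, sub_zero,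
    mul_one] at h1 h2 h3 ⊢
  have hm : (0 : ℝ) ≤ #V := Nat.cast_nonneg _
  nlinarith [mul_le_mul_of_nonneg_left h3 hm]

lemma integral_ramp_sub_sq {a b B : ℝ} (hb : 0 < b) (hba : b ≤ a) (haB : a ≤ B) :
    ∫ s in (0 : ℝ)..B, (max (1 - s / a) 0 - max (1 - s / b) 0) ^ 2 = (a - b) ^ 2 / (3 * a) := by
  have ha : 0 < a := hb.trans_le hba
  have hc : Continuous fun s : ℝ => (max (1 - s / a) 0 - max (1 - s / b) 0) ^ 2 := by fun_prop
  have hi : ∀ x y, IntervalIntegrable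
      (fun s : ℝ => (max (1 - s / a) 0 - max (1 - s / b) 0) ^ 2) MeasureTheory.volume x y :=
    fun x y => hc.intervalIntegrable x y
  rw [← intervalIntegral.integral_add_adjacent_intervals (hi 0 b) (hi b B),
    ← intervalIntegral.integral_add_adjacent_intervals (hi b a) (hi a B)]
  have e1 : ∫ s in (0 : ℝ)..b, (max (1 - s / a) 0 - max (1 - s / b) 0) ^ 2 =
      ∫ s in (0 : ℝ)..b, (1 / b - 1 / a) ^ 2 * s ^ 2 := by
    refine intervalIntegral.integral_congr fun s hs => ?_
    rw [Set.uIcc_of_le hb.le] at hs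
    have h1 : s / b ≤ 1 := (div_le_one hb).2 hs.2
    have h2 : s / a ≤ 1 := (div_le_one ha).2 (hs.2.trans hba)
    rw [max_eq_left (by linarith), max_eq_left (by linarith)]
    ring
  have e2 : ∫ s in b..a, (max (1 - s / a) 0 - max (1 - s / b) 0) ^ 2 =
      ∫ s in b..a, (1 - 2 / a * s + (1 / a ^ 2) * s ^ 2) := by
    refine intervalIntegral.integral_congr fun s hs => ?_
    rw [Set.uIcc_of_le hba] at hs
    have h1 : 1 ≤ s / b := (one_le_div hb).2 hs.1
    have h2 : s / a ≤ 1 := (div_le_one ha).2 hs.2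
    rw [max_eq_left (by linarith), max_eq_right (by linarith)]
    field_simp
    ring
  have e3 : ∫ s in a..B, (max (1 - s / a) 0 - max (1 - s / b) 0) ^ 2 = ∫ s in a..B, (0 : ℝ) := by
    refine intervalIntegral.integral_congr fun s hs => ?_
    rw [Set.uIcc_of_le haB] at hs
    have h1 : 1 ≤ s / b := (one_le_div hb).2 (hba.trans hs.1)
    have h2 : 1 ≤ s / a := (one_le_div ha).2 hs.1
    rw [max_eq_right (by linarith), max_eq_right (by linarith)]
    ring
  rw [e1, e2, e3, intervalIntegral.integral_add, intervalIntegral.integral_sub]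
  · have e4 : ∫ s in b..a, 2 / a * s = 2 / a * ((a ^ 2 - b ^ 2) / 2) := by
      rw [intervalIntegral.integral_const_mul, integral_id]
    rw [e4]
    simp only [intervalIntegral.integral_const_mul, integral_pow,
      intervalIntegral.integral_const, smul_eq_mul]
    field_simp
    ring
  all_goals exact Continuous.intervalIntegrable (by fun_prop) _ _

lemma integral_ramp_sub_sq' {a b B : ℝ} (ha : 0 < a) (hb : 0 < b) (haB : a ≤ B) (hbB : b ≤ B) :
    ∫ s in (0 : ℝ)..B, (max (1 - s / a) 0 - max (1 - s / b) 0) ^ 2 =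
      (a - b) ^ 2 / (3 * max a b) := by
  rcases le_total b a with h | h
  · rw [integral_ramp_sub_sq hb h haB, max_eq_left h]
  · simp_rw [sub_sq_comm (max (1 - _ / a) 0)]
    rw [integral_ramp_sub_sq ha h hbB, max_eq_right h, sub_sq_comm]

/-- The kernel `(a - b)² / max a b` is conditionally negative definite. -/
lemma sum_sq_div_max_le {ι : Type*} (V : Finset ι) (z : ι → ℝ) (hz : ∀ i ∈ V, 0 < z i) :
    ∑ i ∈ V, ∑ j ∈ V, (z i - z j) ^ 2 / max (z i) (z j) ≤
      2 * #V * ∑ i ∈ V, (z i - 1) ^ 2 / max (z i) 1 := by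
  obtain ⟨B, hB1, hB⟩ : ∃ B : ℝ, 1 ≤ B ∧ ∀ i ∈ V, z i ≤ B := by
    refine ⟨1 + ∑ i ∈ V, z i, ?_, fun i hi => ?_⟩
    · linarith [sum_nonneg fun i hi => (hz i hi).le]
    · linarith [single_le_sum (f := z) (fun i hi => (hz i hi).le) hi]
  have key : ∀ a b : ℝ, 0 < a → 0 < b → a ≤ B → b ≤ B → (a - b) ^ 2 / max a b =
      3 * ∫ s in (0 : ℝ)..B, (max (1 - s / a) 0 - max (1 - s / b) 0) ^ 2 := by
    intro a b ha hb h1 h2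
    rw [integral_ramp_sub_sq' ha hb h1 h2]
    have : 0 < max a b := lt_max_of_lt_left ha
    field_simp
  have e1 : ∑ i ∈ V, ∑ j ∈ V, (z i - z j) ^ 2 / max (z i) (z j) =
      3 * ∫ s in (0 : ℝ)..B, ∑ i ∈ V, ∑ j ∈ V,
        (max (1 - s / z i) 0 - max (1 - s / z j) 0) ^ 2 := by
    rw [intervalIntegral.integral_finsetSum
      fun i _ => Continuous.intervalIntegrable (by fun_prop) _ _, mul_sum]
    refine sum_congr rfl fun i hi => ?_
    rw [intervalIntegral.integral_finsetSum
      fun i _ => Continuous.intervalIntegrable (by fun_prop) _ _, mul_sum]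
    exact sum_congr rfl fun j hj => key _ _ (hz i hi) (hz j hj) (hB i hi) (hB j hj)
  have e2 : 2 * #V * ∑ i ∈ V, (z i - 1) ^ 2 / max (z i) 1 =
      3 * ∫ s in (0 : ℝ)..B, 2 * #V * ∑ i ∈ V,
        (max (1 - s / z i) 0 - max (1 - s / 1) 0) ^ 2 := by
    rw [intervalIntegral.integral_const_mul, intervalIntegral.integral_finsetSum
      fun i _ => Continuous.intervalIntegrable (by fun_prop) _ _, mul_left_comm, mul_sum]
    simp only [mul_sum]
    exact sum_congr rfl fun i hi => by rw [key (z i) 1 (hz i hi) one_pos (hB i hi) hB1]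
  rw [e1, e2]
  refine mul_le_mul_of_nonneg_left ?_ (by norm_num)
  refine intervalIntegral.integral_mono_on (by linarith)
    (Continuous.intervalIntegrable (by fun_prop) _ _)
    (Continuous.intervalIntegrable (by fun_prop) _ _) fun s _ => ?_
  exact sum_sum_sub_sq_le V _ _

lemma sum_sq_div_le {ι : Type*} (V : Finset ι) (z : ι → ℝ) (hz : ∀ i ∈ V, 0 < z i)
    (hs : ∑ i ∈ V, z i = #V) :
    ∑ i ∈ V, ∑ j ∈ V, (max (z i - z j) 0) ^ 2 / z i ≤
      2 * #V * ∑ i ∈ V, z i * Real.log (z i) := by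
  have e : ∀ i ∈ V, ∀ j ∈ V, (z i - z j) ^ 2 / max (z i) (z j) =
      (max (z i - z j) 0) ^ 2 / z i + (max (z j - z i) 0) ^ 2 / z j := by
    intro i _ j _
    rcases le_total (z i) (z j) with h | h
    · rw [max_eq_right h, max_eq_right (sub_nonpos.2 h), max_eq_left (sub_nonneg.2 h)]
      ring
    · rw [max_eq_left h, max_eq_left (sub_nonneg.2 h), max_eq_right (sub_nonpos.2 h)]
      ring
  have h1 : ∑ i ∈ V, ∑ j ∈ V, (z i - z j) ^ 2 / max (z i) (z j) =
      2 * ∑ i ∈ V, ∑ j ∈ V, (max (z i - z j) 0) ^ 2 / z i := by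
    rw [sum_congr rfl fun i hi => sum_congr rfl fun j hj => e i hi j hj]
    simp only [sum_add_distrib]
    rw [sum_comm (f := fun i j => (max (z j - z i) 0) ^ 2 / z j)]
    ring
  have h2 := sum_sq_div_max_le V z hz
  have h3 : ∑ i ∈ V, (z i - 1) ^ 2 / max (z i) 1 ≤
      ∑ i ∈ V, 2 * (z i * Real.log (z i) - z i + 1) := by
    refine sum_le_sum fun i hi => ?_
    rcases le_total (z i) 1 with h | h
    · rw [max_eq_right h]
      linarith [half_sq_le_mul_log (hz i hi) h, sub_sq_comm 1 (z i)]
    · rw [max_eq_left h]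
      have := sq_div_le_mul_log h
      rw [mul_comm, ← div_div] at this
      linarith
  simp only [sum_add_distrib, ← mul_sum, sum_const, nsmul_eq_mul, sum_sub_distrib, hs,
    mul_one] at h3
  have hm : (0 : ℝ) ≤ #V := Nat.cast_nonneg _
  nlinarith [mul_le_mul_of_nonneg_left h3 hm]

end EntropyBounds

section Cylinders

open Finset Equiv

variable {α : Type*} [Fintype α] [DecidableEq α]

/-- The permutations which agree with `ρ` outside `T`. -/
def cyl (ρ : Perm α) (T : Finset α) : Finset (Perm α) :=
  univ.filter fun σ => ∀ x, x ∉ T → σ x = ρ x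

lemma mem_cyl {ρ σ : Perm α} {T : Finset α} : σ ∈ cyl ρ T ↔ ∀ x, x ∉ T → σ x = ρ x := by
  simp [cyl]

lemma self_mem_cyl (ρ : Perm α) (T : Finset α) : ρ ∈ cyl ρ T := by simp [mem_cyl]

lemma cyl_empty (ρ : Perm α) : cyl ρ ∅ = {ρ} := by
  ext σ
  simp [mem_cyl, Equiv.ext_iff]

lemma cyl_univ (ρ : Perm α) : cyl ρ univ = univ := by
  ext σ
  simp [mem_cyl]

omit [Fintype α] in
lemma apply_mem_image_iff (ρ : Perm α) (T : Finset α) (x : α) : ρ x ∈ T.image ρ ↔ x ∈ T := by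
  simp

lemma apply_mem_image_of_mem_cyl {ρ σ : Perm α} {T : Finset α} (h : σ ∈ cyl ρ T) (x : α) :
    σ x ∈ T.image ρ ↔ x ∈ T := by
  have key : ∀ x, x ∉ T → σ x ∉ T.image ρ := fun x hx => by
    rw [mem_cyl.1 h x hx]
    simpa using hx
  refine ⟨fun hx => by_contra fun h' => key x h' hx, fun hx => ?_⟩
  by_contra h'
  have h1 : ρ.symm (σ x) ∉ T := by
    simpa [mem_image, eq_comm, Equiv.symm_apply_eq] using fun h2 =>
      h' (mem_image.2 ⟨_, h2, by simp⟩)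
  have h2 := mem_cyl.1 h _ h1
  rw [Equiv.apply_symm_apply] at h2
  rw [σ.injective h2] at h1
  exact h1 hx

lemma image_eq_of_mem_cyl {ρ σ : Perm α} {T : Finset α} (h : σ ∈ cyl ρ T) :
    T.image σ = T.image ρ := by
  refine eq_of_subset_of_card_le (fun y hy => ?_) ?_
  · obtain ⟨x, hx, rfl⟩ := mem_image.1 hy
    exact (apply_mem_image_of_mem_cyl h x).2 hx
  · rw [card_image_of_injective _ σ.injective, card_image_of_injective _ ρ.injective]

/-- The part of `cyl ρ T` with prescribed value `i` at `k`. -/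
def fib (ρ : Perm α) (T : Finset α) (k i : α) : Finset (Perm α) :=
  (cyl ρ T).filter fun σ => σ k = i

lemma mem_fib {ρ σ : Perm α} {T : Finset α} {k i : α} :
    σ ∈ fib ρ T k i ↔ σ ∈ cyl ρ T ∧ σ k = i := by
  simp [fib]

lemma fib_eq_cyl (ρ : Perm α) {T : Finset α} {k i : α} (hk : k ∈ T) (hi : i ∈ T.image ρ) :
    fib ρ T k i = cyl (swap (ρ k) i * ρ) (T.erase k) := by
  ext σ
  have key : ∀ x, x ∉ T → swap (ρ k) i (ρ x) = ρ x := by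
    intro x hx
    refine swap_apply_of_ne_of_ne (fun h => hx (ρ.injective h ▸ hk)) fun h => ?_
    rw [← h, apply_mem_image_iff] at hi
    exact hx hi
  simp only [mem_fib, mem_cyl, Perm.mul_apply, mem_erase, not_and_or, not_not]
  constructor
  · rintro ⟨h1, h2⟩ x (rfl | hx)
    · simp [h2]
    · rw [key x hx, h1 x hx]
  · intro h
    refine ⟨fun x hx => ?_, ?_⟩
    · rw [h x (Or.inr hx), key x hx]
    · simpa using h k (Or.inl rfl)

lemma sum_cyl_eq_sum_fib (ρ : Perm α) {T : Finset α} {k : α} (hk : k ∈ T) (F : Perm α → ℝ) :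
    ∑ i ∈ T.image ρ, ∑ σ ∈ fib ρ T k i, F σ = ∑ σ ∈ cyl ρ T, F σ :=
  sum_fiberwise_of_maps_to (fun _ hσ => (apply_mem_image_of_mem_cyl hσ k).2 hk) F

lemma swap_mul_mem_cyl {ρ σ : Perm α} {T : Finset α} {i j : α} (hi : i ∈ T.image ρ)
    (hj : j ∈ T.image ρ) (h : σ ∈ cyl ρ T) : swap i j * σ ∈ cyl ρ T := by
  rw [mem_cyl]
  intro x hx
  have h1 : ρ x ∉ T.image ρ := by rwa [apply_mem_image_iff]
  rw [Perm.mul_apply, mem_cyl.1 h x hx]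
  exact swap_apply_of_ne_of_ne (fun h => h1 (h ▸ hi)) (fun h => h1 (h ▸ hj))

lemma sum_fib_swap_mul (ρ : Perm α) {T : Finset α} {k i j : α} (hi : i ∈ T.image ρ)
    (hj : j ∈ T.image ρ) (F : Perm α → ℝ) :
    ∑ σ ∈ fib ρ T k i, F (swap i j * σ) = ∑ σ ∈ fib ρ T k j, F σ := by
  refine sum_nbij' (fun σ => swap i j * σ) (fun σ => swap i j * σ) ?_ ?_ ?_ ?_ ?_
  · intro σ hσ
    rw [mem_fib] at hσ ⊢
    exact ⟨swap_mul_mem_cyl hi hj hσ.1, by simp [hσ.2]⟩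
  · intro σ hσ
    rw [mem_fib] at hσ ⊢
    exact ⟨swap_mul_mem_cyl hi hj hσ.1, by simp [hσ.2]⟩
  · simp
  · simp
  · simp

lemma card_fib_eq (ρ : Perm α) {T : Finset α} {k i j : α} (hi : i ∈ T.image ρ)
    (hj : j ∈ T.image ρ) : (#(fib ρ T k i) : ℝ) = #(fib ρ T k j) := by
  simpa using sum_fib_swap_mul ρ (k := k) hi hj fun _ => 1

lemma card_mul_card_fib (ρ : Perm α) {T : Finset α} {k i : α} (hk : k ∈ T)
    (hi : i ∈ T.image ρ) : (#T : ℝ) * #(fib ρ T k i) = #(cyl ρ T) := by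
  have h := sum_cyl_eq_sum_fib ρ hk fun _ => 1
  simp only [sum_const, nsmul_eq_mul, mul_one] at h
  rw [← h, sum_congr rfl fun j hj => card_fib_eq ρ hj hi, sum_const, nsmul_eq_mul,
    card_image_of_injective _ ρ.injective]

lemma fib_nonempty (ρ : Perm α) {T : Finset α} {k i : α} (hk : k ∈ T) (hi : i ∈ T.image ρ) :
    (fib ρ T k i).Nonempty := by
  rw [fib_eq_cyl ρ hk hi]
  exact ⟨_, self_mem_cyl _ _⟩

lemma sum_cyl_apply (ρ : Perm α) {T : Finset α} {k : α} (hk : k ∈ T) (F : α → ℝ) :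
    #T * ∑ σ ∈ cyl ρ T, F (σ k) = #(cyl ρ T) * ∑ i ∈ T.image ρ, F i := by
  rw [← sum_cyl_eq_sum_fib ρ hk, mul_sum, mul_sum]
  refine sum_congr rfl fun i hi => ?_
  rw [sum_congr rfl fun σ hσ => by rw [(mem_fib.1 hσ).2], sum_const, nsmul_eq_mul,
    ← card_mul_card_fib ρ hk hi, mul_assoc]

lemma sum_cyl_apply₂ (ρ : Perm α) {T : Finset α} {k l : α} (hk : k ∈ T) (hl : l ∈ T)
    (hkl : k ≠ l) (F : α → α → ℝ) :
    #T * (#T - 1) * ∑ σ ∈ cyl ρ T, F (σ k) (σ l) =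
      #(cyl ρ T) * ∑ i ∈ T.image ρ, ∑ j ∈ (T.image ρ).erase i, F i j := by
  rw [← sum_cyl_eq_sum_fib ρ hk, mul_sum, mul_sum]
  refine sum_congr rfl fun i hi => ?_
  have hl' : l ∈ T.erase k := mem_erase.2 ⟨hkl.symm, hl⟩
  have h1 := sum_cyl_apply (swap (ρ k) i * ρ) hl' (F i)
  have h2 : (T.erase k).image (swap (ρ k) i * ρ) = (T.image ρ).erase i := by
    obtain ⟨σ, hσ⟩ := fib_nonempty ρ hk hi
    have h3 := hσ
    rw [fib_eq_cyl ρ hk hi] at h3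
    rw [mem_fib] at hσ
    rw [← image_eq_of_mem_cyl h3, ← image_eq_of_mem_cyl hσ.1, image_erase σ.injective, hσ.2]
  rw [h2, ← fib_eq_cyl ρ hk hi, card_erase_of_mem hk,
    Nat.cast_sub (card_pos.2 ⟨k, hk⟩), Nat.cast_one] at h1
  rw [sum_congr rfl fun σ hσ => by rw [(mem_fib.1 hσ).2], mul_assoc, h1,
    ← card_mul_card_fib ρ hk hi, mul_assoc]

end Cylinders

section Transport

open Finset Equiv

/-- Entropy of the density `p` on `X`, relative to the uniform measure. -/
def relEnt {β : Type*} (X : Finset β) (p : β → ℝ) : ℝ :=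
  (∑ x ∈ X, p x * Real.log (p x)) / (∑ x ∈ X, p x) - Real.log ((∑ x ∈ X, p x) / #X)

variable {α : Type*} [Fintype α] [DecidableEq α]

/-- The mass given by `p` to `fib ρ T k i`. -/
def mass (p : Perm α → ℝ) (ρ : Perm α) (T : Finset α) (k i : α) : ℝ :=
  ∑ σ ∈ fib ρ T k i, p σ

/-- The mass given by `p` to `cyl ρ T`. -/
def tot (p : Perm α → ℝ) (ρ : Perm α) (T : Finset α) : ℝ :=
  ∑ σ ∈ cyl ρ T, p σ

/-- The entropy of the law of the coordinate `k` under `p`. -/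
def margEnt (p : Perm α → ℝ) (ρ : Perm α) (T : Finset α) (k : α) : ℝ :=
  ∑ i ∈ T.image ρ, mass p ρ T k i / tot p ρ T * Real.log (#T * mass p ρ T k i / tot p ρ T)

lemma tot_pos {p : Perm α → ℝ} (hp : ∀ σ, 0 < p σ) (ρ : Perm α) (T : Finset α) :
    0 < tot p ρ T :=
  sum_pos (fun σ _ => hp σ) ⟨ρ, self_mem_cyl ρ T⟩

lemma mass_pos {p : Perm α → ℝ} (hp : ∀ σ, 0 < p σ) (ρ : Perm α) {T : Finset α} {k i : α}
    (hk : k ∈ T) (hi : i ∈ T.image ρ) : 0 < mass p ρ T k i :=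
  sum_pos (fun σ _ => hp σ) (fib_nonempty ρ hk hi)

lemma sum_mass (p : Perm α → ℝ) (ρ : Perm α) {T : Finset α} {k : α} (hk : k ∈ T) :
    ∑ i ∈ T.image ρ, mass p ρ T k i = tot p ρ T :=
  sum_cyl_eq_sum_fib ρ hk p

lemma relEnt_chain {p : Perm α → ℝ} (hp : ∀ σ, 0 < p σ) (ρ : Perm α) {T : Finset α} {k : α}
    (hk : k ∈ T) :
    ∑ i ∈ T.image ρ, mass p ρ T k i / tot p ρ T * relEnt (fib ρ T k i) p + margEnt p ρ T k =
      relEnt (cyl ρ T) p := by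
  have hP := tot_pos hp ρ T
  have hm : (0 : ℝ) < #T := by exact_mod_cast card_pos.2 ⟨k, hk⟩
  have key : ∀ i ∈ T.image ρ, mass p ρ T k i / tot p ρ T * relEnt (fib ρ T k i) p +
      mass p ρ T k i / tot p ρ T * Real.log (#T * mass p ρ T k i / tot p ρ T) =
      (∑ σ ∈ fib ρ T k i, p σ * Real.log (p σ)) / tot p ρ T -
        mass p ρ T k i / tot p ρ T * Real.log (tot p ρ T / #(cyl ρ T)) := by
    intro i hi
    have hPi := mass_pos hp ρ hk hi
    have hN : (0 : ℝ) < #(fib ρ T k i) := by exact_mod_cast card_pos.2 (fib_nonempty ρ hk hi)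
    rw [← card_mul_card_fib ρ hk hi, relEnt]
    change _ * (_ / mass p ρ T k i - Real.log (mass p ρ T k i / _)) + _ = _
    rw [Real.log_div hPi.ne' hN.ne', Real.log_div (by positivity) hP.ne',
      Real.log_div hP.ne' (by positivity), Real.log_mul hm.ne' hPi.ne',
      Real.log_mul hm.ne' hN.ne']
    field_simp
    ring
  rw [margEnt, ← sum_add_distrib, sum_congr rfl key, sum_sub_distrib, ← sum_mul, ← sum_div,
    ← sum_div, sum_mass p ρ hk, sum_cyl_eq_sum_fib ρ hk, div_self hP.ne', one_mul]
  rfl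

/-- The part of the linear cost coming from the coordinates in `T`. -/
def cost (w : Perm α → α → ℝ) (T : Finset α) (σ y : Perm α) : ℝ :=
  ∑ x ∈ T, if σ x ≠ y x then w σ x else 0

/-- The cost of exchanging the values `i` and `j`, where `σ k = i`. -/
def exch (w : Perm α → α → ℝ) (k i j : α) (σ : Perm α) : ℝ :=
  if i = j then 0 else w σ k + w σ (σ.symm j)

lemma cost_swap_le {w : Perm α → α → ℝ} (hw : ∀ σ x, 0 ≤ w σ x) {ρ : Perm α} {T : Finset α}
    {k i j : α} (hk : k ∈ T) {σ y : Perm α} (hσ : σ ∈ fib ρ T k i) (hy : y ∈ fib ρ T k i) :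
    cost w T σ (swap i j * y) ≤ cost w (T.erase k) σ y + exch w k i j σ := by
  rw [mem_fib] at hσ hy
  rw [cost, ← add_sum_erase T _ hk, cost, exch]
  split_ifs with h1 h2 h2
  · subst h2
    simp [hσ.2, hy.2] at h1
  · have h3 : ∑ x ∈ T.erase k, (if σ x ≠ (swap i j * y) x then w σ x else 0) ≤
        ∑ x ∈ T.erase k, ((if σ x ≠ y x then w σ x else 0) +
          if x = σ.symm j then w σ (σ.symm j) else 0) := by
      refine sum_le_sum fun x hx => ?_
      by_cases hxj : x = σ.symm j
      · subst hxj
        have := hw σ (σ.symm j)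
        rw [if_pos rfl]
        split_ifs <;> linarith
      · rw [if_neg hxj, add_zero]
        by_cases hxy : σ x = y x
        · have h4 : swap i j (y x) = y x := by
            rw [← hxy]
            refine swap_apply_of_ne_of_ne (fun h => ?_) fun h => hxj ?_
            · rw [← hσ.2] at h
              exact (mem_erase.1 hx).1 (σ.injective h)
            · rw [← h, Equiv.symm_apply_apply]
          rw [Perm.mul_apply, h4]
        · rw [if_pos hxy]
          have := hw σ x
          split_ifs <;> linarith
    have h5 : ∑ x ∈ T.erase k, (if x = σ.symm j then w σ (σ.symm j) else 0) ≤
        w σ (σ.symm j) := by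
      rw [sum_ite_eq']
      split_ifs
      · exact le_rfl
      · exact hw _ _
    rw [sum_add_distrib] at h3
    linarith
  · subst h2
    have h3 : swap i i * y = y := by
      rw [swap_self]
      rfl
    rw [h3, zero_add, add_zero]
  · exfalso
    rw [not_not, Perm.mul_apply, hσ.2, hy.2, swap_apply_left] at h1
    exact h2 h1

/-- Existence of transport plans between all pairs of one-coordinate marginals with a good
total cost. -/
def HasPlans (w : Perm α → α → ℝ) (κ c : ℝ) (p q : Perm α → ℝ) : Prop :=
  ∀ (ρ : Perm α) (T : Finset α), T.Nonempty → ∃ π : α → α → α → ℝ,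
    (∀ k ∈ T, ∀ i ∈ T.image ρ, ∀ j ∈ T.image ρ, 0 ≤ π k i j) ∧
    (∀ k ∈ T, ∀ i ∈ T.image ρ, ∑ j ∈ T.image ρ, π k i j = mass p ρ T k i / tot p ρ T) ∧
    (∀ k ∈ T, ∀ j ∈ T.image ρ, ∑ i ∈ T.image ρ, π k i j = mass q ρ T k j / tot q ρ T) ∧
    ∑ k ∈ T, ∑ i ∈ T.image ρ, ∑ j ∈ T.image ρ,
        π k i j * ((∑ σ ∈ fib ρ T k i, p σ * exch w k i j σ) / mass p ρ T k i) ≤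
      κ * ((∑ σ ∈ cyl ρ T, p σ * ∑ x ∈ T, w σ x ^ 2) / tot p ρ T) +
        c * ∑ k ∈ T, (margEnt p ρ T k + margEnt q ρ T k)

omit [Fintype α] [DecidableEq α] in
lemma sum_plan_le {V : Finset α} {π : α → α → ℝ} {r s a b e f : α → ℝ} {d : α → α → ℝ}
    (h0 : ∀ i ∈ V, ∀ j ∈ V, 0 ≤ π i j) (h1 : ∀ i ∈ V, ∑ j ∈ V, π i j = r i)
    (h2 : ∀ j ∈ V, ∑ i ∈ V, π i j = s j)
    (h : ∀ i ∈ V, ∀ j ∈ V, a i - d i j - b j ≤ e i + f j) :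
    ∑ i ∈ V, r i * a i - ∑ j ∈ V, s j * b j ≤
      ∑ i ∈ V, ∑ j ∈ V, π i j * d i j + (∑ i ∈ V, r i * e i + ∑ j ∈ V, s j * f j) := by
  have h3 : ∀ g : α → ℝ, ∑ i ∈ V, r i * g i = ∑ i ∈ V, ∑ j ∈ V, π i j * g i := fun g =>
    sum_congr rfl fun i hi => by rw [← h1 i hi, sum_mul]
  have h4 : ∀ g : α → ℝ, ∑ j ∈ V, s j * g j = ∑ i ∈ V, ∑ j ∈ V, π i j * g j := fun g => by
    rw [sum_comm]
    exact sum_congr rfl fun i hi => by rw [← h2 i hi, sum_mul]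
  rw [h3, h3, h4, h4, ← sub_nonneg]
  simp only [← sum_add_distrib, ← sum_sub_distrib]
  refine sum_nonneg fun i hi => sum_nonneg fun j hj => ?_
  nlinarith [mul_le_mul_of_nonneg_left (h i hi j hj) (h0 i hi j hj)]

/-- If suitable one-coordinate transport plans exist, then `p` and `q` satisfy a weak transport
inequality, here in its dual form. -/
lemma transport_inequality {w : Perm α → α → ℝ} (hw : ∀ σ x, 0 ≤ w σ x) {κ c : ℝ}
    {p q : Perm α → ℝ} (hp : ∀ σ, 0 < p σ) (hq : ∀ σ, 0 < q σ)
    (plans : ∀ τ : Perm α, HasPlans w κ c p fun y => q (τ * y)) (T : Finset α) :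
    ∀ (ρ τ : Perm α) (u v : Perm α → ℝ),
      (∀ σ ∈ cyl ρ T, ∀ y ∈ cyl ρ T, u σ - v y ≤ cost w T σ y) →
      (∑ σ ∈ cyl ρ T, p σ * u σ) / tot p ρ T -
          (∑ y ∈ cyl ρ T, q (τ * y) * v y) / tot (fun y => q (τ * y)) ρ T ≤
        κ * ((∑ σ ∈ cyl ρ T, p σ * ∑ x ∈ T, w σ x ^ 2) / tot p ρ T) +
          c * (relEnt (cyl ρ T) p + relEnt (cyl ρ T) fun y => q (τ * y)) := by
  induction T using Finset.strongInduction with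
  | H T ih =>
  intro ρ τ u v huv
  rcases T.eq_empty_or_nonempty with rfl | hT
  · have h := huv ρ (self_mem_cyl _ _) ρ (self_mem_cyl _ _)
    have h1 := (hp ρ).ne'
    have h2 := (hq (τ * ρ)).ne'
    simp only [cost, sum_empty] at h
    simp only [tot, relEnt, cyl_empty, sum_singleton, sum_empty, card_singleton, Nat.cast_one,
      div_one, mul_zero, zero_div]
    rw [mul_div_cancel_left₀ _ h1, mul_div_cancel_left₀ _ h2, mul_div_cancel_left₀ _ h1,
      mul_div_cancel_left₀ _ h2]
    linarith
  obtain ⟨π, h0, h1, h2, h3⟩ := plans τ ρ T hT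
  set q₁ : Perm α → ℝ := fun y => q (τ * y) with hq₁
  have hq₁' : ∀ σ, 0 < q₁ σ := fun σ => hq _
  have hP := tot_pos hp ρ T
  have hQ := tot_pos hq₁' ρ T
  have step : ∀ k ∈ T, (∑ σ ∈ cyl ρ T, p σ * u σ) / tot p ρ T -
      (∑ y ∈ cyl ρ T, q₁ y * v y) / tot q₁ ρ T ≤
      ∑ i ∈ T.image ρ, ∑ j ∈ T.image ρ,
        π k i j * ((∑ σ ∈ fib ρ T k i, p σ * exch w k i j σ) / mass p ρ T k i) +
      (κ * ((∑ σ ∈ cyl ρ T, p σ * ∑ x ∈ T.erase k, w σ x ^ 2) / tot p ρ T) +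
        c * (relEnt (cyl ρ T) p - margEnt p ρ T k) +
        c * (relEnt (cyl ρ T) q₁ - margEnt q₁ ρ T k)) := by
    intro k hk
    have hloc : ∀ i ∈ T.image ρ, ∀ j ∈ T.image ρ,
        (∑ σ ∈ fib ρ T k i, p σ * u σ) / mass p ρ T k i -
        (∑ σ ∈ fib ρ T k i, p σ * exch w k i j σ) / mass p ρ T k i -
        (∑ y ∈ fib ρ T k j, q₁ y * v y) / mass q₁ ρ T k j ≤
        (κ * ((∑ σ ∈ fib ρ T k i, p σ * ∑ x ∈ T.erase k, w σ x ^ 2) / mass p ρ T k i) +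
          c * relEnt (fib ρ T k i) p) + c * relEnt (fib ρ T k j) q₁ := by
      intro i hi j hj
      have := ih (T.erase k) (erase_ssubset hk) (swap (ρ k) i * ρ) (τ * swap i j)
        (fun σ => u σ - exch w k i j σ) (fun y => v (swap i j * y)) ?_
      · simp only [tot, ← fib_eq_cyl ρ hk hi, mul_assoc, mul_sub, sum_sub_distrib] at this
        change _ - (∑ y ∈ fib ρ T k i, q₁ (swap i j * y) * _) /
          (∑ y ∈ fib ρ T k i, q₁ (swap i j * y)) ≤
          _ + c * (_ + relEnt _ fun y => q₁ (swap i j * y)) at this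
        rw [sum_fib_swap_mul ρ hi hj, sum_fib_swap_mul ρ hi hj fun y => q₁ y * v y] at this
        have e : relEnt (fib ρ T k i) (fun y => q₁ (swap i j * y)) =
            relEnt (fib ρ T k j) q₁ := by
          rw [relEnt, relEnt, sum_fib_swap_mul ρ hi hj, card_fib_eq ρ hi hj,
            sum_fib_swap_mul ρ hi hj fun y => q₁ y * Real.log (q₁ y)]
        rw [e] at this
        simp only [mass]
        rw [sub_div] at this
        linarith
      · intro σ hσ y hy
        rw [← fib_eq_cyl ρ hk hi] at hσ hy
        have h4 := cost_swap_le hw (j := j) hk hσ hy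
        have h5 := huv σ (mem_fib.1 hσ).1 _ (swap_mul_mem_cyl hi hj (mem_fib.1 hy).1)
        linarith
    have := sum_plan_le (h0 k hk) (h1 k hk) (h2 k hk) hloc
    have e : ∀ {p : Perm α → ℝ} (hp : ∀ σ, 0 < p σ) (g : Perm α → ℝ),
        ∑ i ∈ T.image ρ, mass p ρ T k i / tot p ρ T *
          ((∑ σ ∈ fib ρ T k i, g σ) / mass p ρ T k i) =
        (∑ σ ∈ cyl ρ T, g σ) / tot p ρ T := by
      intro p hp g
      rw [← sum_cyl_eq_sum_fib ρ hk, sum_div]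
      refine sum_congr rfl fun i hi => ?_
      have := (mass_pos hp ρ hk hi).ne'
      field_simp
    have e2 := relEnt_chain hp ρ hk
    have e3 := relEnt_chain hq₁' ρ hk
    simp only [mul_add, sum_add_distrib, mul_left_comm _ c, mul_left_comm _ κ, ← mul_sum] at this
    rw [e hp, e hq₁', e hp] at this
    rw [← e2, ← e3]
    linarith
  have hsum := sum_le_sum step
  simp only [sum_const, nsmul_eq_mul, sum_add_distrib, ← mul_sum, sum_sub_distrib,
    ← sum_div] at hsum h3
  have e4 : ∑ k ∈ T, ∑ σ ∈ cyl ρ T, p σ * ∑ x ∈ T.erase k, w σ x ^ 2 =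
      (#T - 1) * ∑ σ ∈ cyl ρ T, p σ * ∑ x ∈ T, w σ x ^ 2 := by
    rw [sum_comm, mul_sum]
    refine sum_congr rfl fun σ _ => ?_
    have : ∀ k ∈ T, p σ * ∑ x ∈ T.erase k, w σ x ^ 2 =
        p σ * ∑ x ∈ T, w σ x ^ 2 - p σ * w σ k ^ 2 := fun k hk => by
      rw [← add_sum_erase T _ hk]
      ring
    rw [sum_congr rfl this, sum_sub_distrib, ← mul_sum, ← mul_sum, sum_const, nsmul_eq_mul]
    ring
  rw [e4] at hsum
  have hm : (0 : ℝ) < #T := by exact_mod_cast card_pos.2 hT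
  refine le_of_mul_le_mul_left ?_ hm
  have e5 : ((#T : ℝ) - 1) * (∑ σ ∈ cyl ρ T, p σ * ∑ x ∈ T, w σ x ^ 2) / tot p ρ T =
      #T * ((∑ σ ∈ cyl ρ T, p σ * ∑ x ∈ T, w σ x ^ 2) / tot p ρ T) -
        (∑ σ ∈ cyl ρ T, p σ * ∑ x ∈ T, w σ x ^ 2) / tot p ρ T := by ring
  rw [e5] at hsum
  linarith

end Transport

section Plans

open Finset Equiv

lemma exists_plan {α : Type*} [DecidableEq α] (V : Finset α) (r s : α → ℝ)
    (hV : ∑ i ∈ V, r i = ∑ i ∈ V, s i)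
    (h : ∀ i ∈ V, ∑ j ∈ V, max (r i - s i - (r j - s j)) 0 ≤ #V * r i) :
    ∃ π : α → α → ℝ, (∀ i ∈ V, ∀ j ∈ V, 0 ≤ π i j) ∧ (∀ i ∈ V, ∑ j ∈ V, π i j = r i) ∧
      (∀ j ∈ V, ∑ i ∈ V, π i j = s j) ∧
      ∀ i j, i ≠ j → π i j = max (r i - s i - (r j - s j)) 0 / #V := by
  refine ⟨fun i j => max (r i - s i - (r j - s j)) 0 / #V +
    if i = j then r i - (∑ l ∈ V, max (r i - s i - (r l - s l)) 0) / #V else 0, ?_, ?_, ?_, ?_⟩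
  · intro i hi j hj
    have hm : (0 : ℝ) < #V := by exact_mod_cast card_pos.2 ⟨i, hi⟩
    have h1 : (∑ l ∈ V, max (r i - s i - (r l - s l)) 0) / #V ≤ r i :=
      (div_le_iff₀' hm).2 (h i hi)
    have h2 : 0 ≤ max (r i - s i - (r j - s j)) 0 / #V :=
      div_nonneg (le_max_right _ _) hm.le
    dsimp only
    split_ifs <;> linarith
  · intro i hi
    rw [sum_add_distrib, sum_ite_eq, if_pos hi, ← sum_div]
    ring
  · intro j hj
    have hm : (#V : ℝ) ≠ 0 := by exact_mod_cast (card_pos.2 ⟨j, hj⟩).ne'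
    rw [sum_add_distrib, sum_ite_eq', if_pos hj, ← sum_div]
    have h1 : ∑ i ∈ V, max (r i - s i - (r j - s j)) 0 -
        ∑ i ∈ V, max (r j - s j - (r i - s i)) 0 = - (#V * (r j - s j)) := by
      rw [← sum_sub_distrib]
      have : ∀ i ∈ V, max (r i - s i - (r j - s j)) 0 - max (r j - s j - (r i - s i)) 0 =
          (r i - s i) - (r j - s j) := fun i _ => by
        rcases le_total (r i - s i) (r j - s j) with h | h
        · rw [max_eq_right (by linarith), max_eq_left (by linarith)]
          ring
        · rw [max_eq_left (by linarith), max_eq_right (by linarith)]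
          ring
      rw [sum_congr rfl this, sum_sub_distrib, sum_sub_distrib, hV, sum_const, nsmul_eq_mul]
      ring
    field_simp
    linarith
  · intro i j hij
    simp [hij]

variable {α : Type*} [Fintype α] [DecidableEq α]

/-- The density of the law of coordinate `k` under `p`, with respect to the uniform law. -/
def margDens (p : Perm α → ℝ) (ρ : Perm α) (T : Finset α) (k i : α) : ℝ :=
  #T * mass p ρ T k i / tot p ρ T

variable {p : Perm α → ℝ} (ρ : Perm α) {T : Finset α} {k : α}

lemma margDens_pos (hp : ∀ σ, 0 < p σ) (hk : k ∈ T) {i : α} (hi : i ∈ T.image ρ) :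
    0 < margDens p ρ T k i := by
  have h1 := tot_pos hp ρ T
  have h2 := mass_pos hp ρ hk hi
  have hm : (0 : ℝ) < #T := by exact_mod_cast card_pos.2 ⟨k, hk⟩
  rw [margDens]
  positivity

lemma sum_margDens (hp : ∀ σ, 0 < p σ) (hk : k ∈ T) :
    ∑ i ∈ T.image ρ, margDens p ρ T k i = #T := by
  simp only [margDens, ← sum_div, ← mul_sum]
  rw [sum_mass p ρ hk, mul_div_cancel_right₀ _ (tot_pos hp ρ T).ne']

lemma mass_div_tot (hk : k ∈ T) (i : α) :
    mass p ρ T k i / tot p ρ T = margDens p ρ T k i / #T := by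
  have hm : (#T : ℝ) ≠ 0 := by exact_mod_cast (card_pos.2 ⟨k, hk⟩).ne'
  rw [margDens]
  field_simp

lemma mass_eq (hp : ∀ σ, 0 < p σ) (hk : k ∈ T) (i : α) :
    mass p ρ T k i = tot p ρ T * margDens p ρ T k i / #T := by
  have hm : (#T : ℝ) ≠ 0 := by exact_mod_cast (card_pos.2 ⟨k, hk⟩).ne'
  have := (tot_pos hp ρ T).ne'
  rw [margDens]
  field_simp

lemma margEnt_eq (hk : k ∈ T) : margEnt p ρ T k =
    (∑ i ∈ T.image ρ, margDens p ρ T k i * Real.log (margDens p ρ T k i)) / #T := by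
  rw [margEnt, sum_div]
  refine sum_congr rfl fun i _ => ?_
  rw [mass_div_tot ρ hk, ← margDens]
  ring

lemma margDens_one (hk : k ∈ T) {i : α} (hi : i ∈ T.image ρ) :
    margDens (fun _ => 1) ρ T k i = 1 := by
  simp only [margDens, mass, tot, sum_const, nsmul_eq_mul, mul_one]
  rw [card_mul_card_fib ρ hk hi, div_self]
  exact_mod_cast (card_pos.2 ⟨ρ, self_mem_cyl ρ T⟩).ne'

lemma margEnt_one (hk : k ∈ T) : margEnt (fun _ => 1) ρ T k = 0 := by
  rw [margEnt_eq ρ hk, sum_congr rfl fun i hi => by rw [margDens_one ρ hk hi, Real.log_one]]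
  simp

lemma sum_exch_eq (p : Perm α → ℝ) (w : Perm α → α → ℝ) (hk : k ∈ T) (π : α → α → ℝ) :
    ∑ i ∈ T.image ρ, ∑ j ∈ T.image ρ,
      π i j * ((∑ σ ∈ fib ρ T k i, p σ * exch w k i j σ) / mass p ρ T k i) =
    ∑ σ ∈ cyl ρ T, p σ * ∑ l ∈ T, π (σ k) (σ l) / mass p ρ T k (σ k) *
      (if k = l then 0 else w σ k + w σ l) := by
  rw [← sum_cyl_eq_sum_fib ρ hk]
  refine sum_congr rfl fun i hi => ?_
  simp only [sum_div, mul_sum]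
  rw [sum_comm]
  refine sum_congr rfl fun σ hσ => ?_
  rw [mem_fib] at hσ
  rw [← image_eq_of_mem_cyl hσ.1, sum_image σ.injective.injOn]
  refine sum_congr rfl fun l _ => ?_
  have : exch w k i (σ l) σ = if k = l then 0 else w σ k + w σ l := by
    simp [exch, ← hσ.2]
  rw [this, hσ.2]
  ring

omit [Fintype α] [DecidableEq α] in
lemma sum_max_sub_le (V : Finset α) {z : α → ℝ} (hz : ∀ i ∈ V, 0 ≤ z i) {a : ℝ} (ha : 0 ≤ a) :
    ∑ j ∈ V, max (a - z j) 0 ≤ #V * a := by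
  rw [← nsmul_eq_mul, ← sum_const]
  exact sum_le_sum fun j hj => max_le (by linarith [hz j hj]) ha

lemma hasPlans_one_right {w : Perm α → α → ℝ} (hp : ∀ σ, 0 < p σ) :
    HasPlans w (1 / 4) 8 p fun _ => 1 := by
  intro ρ T hT
  have hm : (0 : ℝ) < #T := by exact_mod_cast card_pos.2 hT
  have hP := tot_pos hp ρ T
  have hc : #(T.image ρ) = #T := card_image_of_injective _ ρ.injective
  have hone : ∀ σ : Perm α, (0 : ℝ) < (fun _ => 1 : Perm α → ℝ) σ := fun _ => one_pos
  have hex : ∀ k ∈ T, ∃ π : α → α → ℝ,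
      (∀ i ∈ T.image ρ, ∀ j ∈ T.image ρ, 0 ≤ π i j) ∧
      (∀ i ∈ T.image ρ, ∑ j ∈ T.image ρ, π i j = mass p ρ T k i / tot p ρ T) ∧
      (∀ j ∈ T.image ρ, ∑ i ∈ T.image ρ, π i j =
        mass (fun _ => 1) ρ T k j / tot (fun _ => 1) ρ T) ∧
      ∀ i ∈ T.image ρ, ∀ j ∈ T.image ρ, i ≠ j →
        π i j = max (margDens p ρ T k i - margDens p ρ T k j) 0 / #T ^ 2 := by
    intro k hk
    have e : ∀ i ∈ T.image ρ, ∀ j ∈ T.image ρ,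
        max (margDens p ρ T k i / #T - margDens (fun _ => 1) ρ T k i / #T -
          (margDens p ρ T k j / #T - margDens (fun _ => 1) ρ T k j / #T)) 0 =
        max (margDens p ρ T k i - margDens p ρ T k j) 0 / #T := by
      intro i hi j hj
      rw [margDens_one ρ hk hi, margDens_one ρ hk hj, ← max_div_div_right hm.le, zero_div]
      congr 1
      ring
    obtain ⟨π, h1, h2, h3, h4⟩ := exists_plan (T.image ρ) (fun i => margDens p ρ T k i / #T)
      (fun i => margDens (fun _ => 1) ρ T k i / #T)
      (by rw [← sum_div, ← sum_div, sum_margDens ρ hp hk, sum_margDens ρ hone hk])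
      (by
        intro i hi
        rw [sum_congr rfl fun j hj => e i hi j hj, ← sum_div, hc,
          mul_div_cancel₀ _ hm.ne', div_le_iff₀' hm]
        have := sum_max_sub_le (T.image ρ) (fun j hj => (margDens_pos ρ hp hk hj).le)
          (margDens_pos ρ hp hk hi).le
        rwa [hc] at this)
    refine ⟨π, h1, fun i hi => ?_, fun j hj => ?_, fun i hi j hj hij => ?_⟩
    · rw [mass_div_tot ρ hk, h2 i hi]
    · rw [mass_div_tot ρ hk, h3 j hj]
    · rw [h4 i j hij, e i hi j hj, hc]
      ring
  choose! π h1 h2 h3 h4 using hex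
  refine ⟨π, h1, h2, h3, ?_⟩
  set z := margDens p ρ T with hz
  set x : α → α → α → ℝ := fun k i j => max (z k i - z k j) 0 / z k i with hx
  have hlhs : ∀ k ∈ T, ∑ i ∈ T.image ρ, ∑ j ∈ T.image ρ,
      π k i j * ((∑ σ ∈ fib ρ T k i, p σ * exch w k i j σ) / mass p ρ T k i) ≤
      (∑ σ ∈ cyl ρ T, p σ * ∑ l ∈ T, (w σ k ^ 2 + w σ l ^ 2)) / (8 * #T * tot p ρ T) +
      4 * (∑ σ ∈ cyl ρ T, p σ * ∑ l ∈ T, x k (σ k) (σ l) ^ 2) / (#T * tot p ρ T) := by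
    intro k hk
    rw [sum_exch_eq ρ p w hk]
    have e1 : ∀ a b : ℝ, a / (8 * #T * tot p ρ T) + 4 * b / (#T * tot p ρ T) =
        (a / 8 + 4 * b) / (#T * tot p ρ T) := by
      intro a b
      field_simp
    rw [e1, le_div_iff₀ (by positivity), sum_div, mul_sum, ← sum_add_distrib, sum_mul]
    refine sum_le_sum fun σ hσ => ?_
    have e2 : ∀ a b : ℝ, p σ * a / 8 + 4 * (p σ * b) = p σ * (a / 8 + 4 * b) := by
      intro a b
      ring
    rw [e2, mul_assoc]
    refine mul_le_mul_of_nonneg_left ?_ (hp σ).le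
    rw [sum_div, mul_sum, ← sum_add_distrib, sum_mul]
    refine sum_le_sum fun l hl => ?_
    have hσk := (apply_mem_image_of_mem_cyl hσ k).2 hk
    have hσl := (apply_mem_image_of_mem_cyl hσ l).2 hl
    have hzk : 0 < z k (σ k) := margDens_pos ρ hp hk hσk
    split_ifs with hkl
    · rw [mul_zero, zero_mul]
      positivity
    · have e3 : π k (σ k) (σ l) / mass p ρ T k (σ k) * (w σ k + w σ l) * (#T * tot p ρ T) =
          x k (σ k) (σ l) * (w σ k + w σ l) := by
        rw [h4 k hk _ hσk _ hσl (fun h => hkl (σ.injective h)), mass_eq ρ hp hk, ← hz, hx]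
        field_simp
      rw [e3]
      nlinarith [sq_nonneg (w σ k - w σ l), sq_nonneg (w σ k + w σ l - 8 * x k (σ k) (σ l))]
  refine (sum_le_sum hlhs).trans ?_
  rw [sum_add_distrib]
  refine add_le_add (le_of_eq ?_) ?_
  · rw [← sum_div, sum_comm]
    have : ∀ σ : Perm α, ∑ k ∈ T, p σ * ∑ l ∈ T, (w σ k ^ 2 + w σ l ^ 2) =
        2 * #T * (p σ * ∑ x ∈ T, w σ x ^ 2) := by
      intro σ
      simp only [← mul_sum, sum_add_distrib, sum_const, nsmul_eq_mul]
      ring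
    simp only [this, ← mul_sum]
    field_simp
    ring
  · rw [mul_sum]
    refine sum_le_sum fun k hk => ?_
    rw [margEnt_one ρ hk, add_zero, margEnt_eq ρ hk, ← hz]
    have e1 : ∑ σ ∈ cyl ρ T, p σ * ∑ l ∈ T, x k (σ k) (σ l) ^ 2 =
        tot p ρ T / #T * ∑ i ∈ T.image ρ, ∑ j ∈ T.image ρ, max (z k i - z k j) 0 ^ 2 / z k i := by
      rw [← sum_cyl_eq_sum_fib ρ hk, mul_sum]
      refine sum_congr rfl fun i hi => ?_
      have : ∀ σ ∈ fib ρ T k i, p σ * ∑ l ∈ T, x k (σ k) (σ l) ^ 2 =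
          p σ * ∑ j ∈ T.image ρ, x k i j ^ 2 := by
        intro σ hσ
        rw [mem_fib] at hσ
        rw [← image_eq_of_mem_cyl hσ.1, sum_image σ.injective.injOn, hσ.2]
      rw [sum_congr rfl this, ← sum_mul]
      change mass p ρ T k i * _ = _
      have hzi : 0 < z k i := margDens_pos ρ hp hk hi
      rw [mass_eq ρ hp hk, ← hz, mul_sum, mul_sum]
      refine sum_congr rfl fun j hj => ?_
      rw [hx]
      field_simp
    have h5 := sum_sq_div_le (T.image ρ) (z k) (fun i hi => margDens_pos ρ hp hk hi)
      (by rw [hc]; exact sum_margDens ρ hp hk)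
    rw [hc] at h5
    rw [e1]
    calc _ = 4 / #T ^ 2 * ∑ i ∈ T.image ρ, ∑ j ∈ T.image ρ,
          max (z k i - z k j) 0 ^ 2 / z k i := by field_simp
      _ ≤ 4 / #T ^ 2 * (2 * #T * ∑ i ∈ T.image ρ, z k i * Real.log (z k i)) :=
          mul_le_mul_of_nonneg_left h5 (by positivity)
      _ = _ := by field_simp; ring

end Plans

section PlansOfBounded

open Finset Equiv

variable {α : Type*} [Fintype α] [DecidableEq α]

lemma sum_pairs (ρ : Perm α) (T : Finset α) (F : α → α → α → α → ℝ)
    (hF : ∀ k l i, F k l i i = 0) :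
    #T * (#T - 1) * ∑ σ ∈ cyl ρ T, ∑ k ∈ T, ∑ l ∈ T, F k l (σ k) (σ l) =
      #(cyl ρ T) * ∑ k ∈ T, ∑ l ∈ T.erase k, ∑ i ∈ T.image ρ, ∑ j ∈ T.image ρ, F k l i j := by
  have e1 : ∑ σ ∈ cyl ρ T, ∑ k ∈ T, ∑ l ∈ T, F k l (σ k) (σ l) =
      ∑ k ∈ T, ∑ l ∈ T.erase k, ∑ σ ∈ cyl ρ T, F k l (σ k) (σ l) := by
    rw [sum_comm]
    refine sum_congr rfl fun k hk => ?_
    rw [sum_comm, ← add_sum_erase T _ hk]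
    simp [hF]
  rw [e1, mul_sum, mul_sum]
  refine sum_congr rfl fun k hk => ?_
  rw [mul_sum, mul_sum]
  refine sum_congr rfl fun l hl => ?_
  rw [sum_cyl_apply₂ ρ hk (mem_erase.1 hl).2 (mem_erase.1 hl).1.symm]
  congr 1
  refine sum_congr rfl fun i hi => ?_
  rw [← add_sum_erase _ _ hi, hF, zero_add]

lemma mul_le_weighted_sq_add_sq {m : ℝ} (hm : 1 < m) (s u : ℝ) :
    s * u ≤ m / (4 * (m - 1)) * u ^ 2 + (m - 1) / m * s ^ 2 := by
  have h0 : 0 < m := by linarith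
  have h1 : 0 < m - 1 := by linarith
  have h2 : m / (4 * (m - 1)) * u ^ 2 + (m - 1) / m * s ^ 2 - s * u =
      (m * u - 2 * (m - 1) * s) ^ 2 / (4 * m * (m - 1)) := by
    field_simp
    ring
  have h3 : 0 ≤ (m * u - 2 * (m - 1) * s) ^ 2 / (4 * m * (m - 1)) := by positivity
  linarith

omit [Fintype α] in
/-- A truncation bound for a single permutation; `x k l` plays the role of the jump of the
density at `k` between the values at `k` and `l`. -/
lemma sum_sum_mul_le {T : Finset α} (hT : 2 ≤ #T) {x : α → α → ℝ} {a : α → ℝ}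
    (hxd : ∀ k, x k k = 0) (ha1 : ∀ k, a k ≤ 1) :
    ∑ k ∈ T, ∑ l ∈ T, x k l * (if k = l then 0 else a k + a l) ≤
      #T / 2 * ∑ k ∈ T, a k ^ 2 +
      (#T - 1) / #T * ∑ k ∈ T, ∑ l ∈ T,
        ((min (x k l) 1) ^ 2 + min (x k l) 1 * min (x l k) 1) +
      2 * ∑ k ∈ T, ∑ l ∈ T, max (x k l - 1) 0 := by
  have hm : (2 : ℝ) ≤ #T := by exact_mod_cast hT
  have hm0 : (0 : ℝ) < #T := by linarith
  have hm1 : (0 : ℝ) < #T - 1 := by linarith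
  have hpt : ∀ k ∈ T, ∀ l ∈ T, (x k l + x l k) * (if k = l then 0 else a k + a l) ≤
      #T / (4 * (#T - 1)) * (if k = l then 0 else 2 * (a k ^ 2 + a l ^ 2)) +
      (#T - 1) / #T * (min (x k l) 1 + min (x l k) 1) ^ 2 +
      2 * (max (x k l - 1) 0 + max (x l k - 1) 0) := by
    intro k _ l _
    split_ifs with hkl
    · subst hkl
      simp [hxd]
    · have e : ∀ y : ℝ, y = min y 1 + max (y - 1) 0 := by
        intro y
        rcases le_total y 1 with h | h
        · rw [min_eq_left h, max_eq_right (by linarith)]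
          ring
        · rw [min_eq_right h, max_eq_left (by linarith)]
          ring
      have h1 := le_max_right (x k l - 1) 0
      have h2 := le_max_right (x l k - 1) 0
      have h3 := mul_le_weighted_sq_add_sq (by linarith : (1 : ℝ) < #T)
        (min (x k l) 1 + min (x l k) 1) (a k + a l)
      have h4 : (#T : ℝ) / (4 * (#T - 1)) * (a k + a l) ^ 2 ≤
          #T / (4 * (#T - 1)) * (2 * (a k ^ 2 + a l ^ 2)) :=
        mul_le_mul_of_nonneg_left (by nlinarith [sq_nonneg (a k - a l)])
          (div_nonneg hm0.le (by linarith))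
      have h5 : (x k l + x l k) * (a k + a l) =
          (min (x k l) 1 + min (x l k) 1) * (a k + a l) +
          (max (x k l - 1) 0 + max (x l k - 1) 0) * (a k + a l) := by
        rw [← add_mul]
        congr 1
        linarith [e (x k l), e (x l k)]
      have h6 : (max (x k l - 1) 0 + max (x l k - 1) 0) * (a k + a l) ≤
          (max (x k l - 1) 0 + max (x l k - 1) 0) * 2 :=
        mul_le_mul_of_nonneg_left (by linarith [ha1 k, ha1 l]) (by linarith)
      linarith
  have hsum := sum_le_sum fun k hk => sum_le_sum fun l hl => hpt k hk l hl
  have e1 : ∑ k ∈ T, ∑ l ∈ T, (x k l + x l k) * (if k = l then 0 else a k + a l) =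
      2 * ∑ k ∈ T, ∑ l ∈ T, x k l * (if k = l then 0 else a k + a l) := by
    simp only [add_mul, sum_add_distrib]
    rw [two_mul]
    congr 1
    rw [sum_comm]
    refine sum_congr rfl fun k _ => sum_congr rfl fun l _ => ?_
    congr 1
    by_cases h : k = l
    · rw [if_pos h, if_pos h.symm]
    · rw [if_neg h, if_neg (Ne.symm h), add_comm]
  have e2 : ∑ k ∈ T, ∑ l ∈ T, (if k = l then 0 else 2 * (a k ^ 2 + a l ^ 2)) =
      4 * (#T - 1) * ∑ k ∈ T, a k ^ 2 := by
    have : ∀ k ∈ T, ∑ l ∈ T, (if k = l then 0 else 2 * (a k ^ 2 + a l ^ 2)) =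
        2 * #T * a k ^ 2 + 2 * ∑ l ∈ T, a l ^ 2 - 4 * a k ^ 2 := by
      intro k hk
      have h1 : ∀ l ∈ T, (if k = l then 0 else 2 * (a k ^ 2 + a l ^ 2)) =
          2 * (a k ^ 2 + a l ^ 2) - if k = l then 4 * a k ^ 2 else 0 := by
        intro l _
        split_ifs with h
        · subst h
          ring
        · ring
      rw [sum_congr rfl h1, sum_sub_distrib, sum_ite_eq, if_pos hk, ← mul_sum, sum_add_distrib,
        sum_const, nsmul_eq_mul]
      ring
    rw [sum_congr rfl this, sum_sub_distrib, sum_add_distrib, sum_const, nsmul_eq_mul]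
    simp only [← mul_sum]
    ring
  have e3 : ∑ k ∈ T, ∑ l ∈ T, (min (x k l) 1 + min (x l k) 1) ^ 2 =
      2 * ∑ k ∈ T, ∑ l ∈ T, ((min (x k l) 1) ^ 2 + min (x k l) 1 * min (x l k) 1) := by
    have : ∀ k l, (min (x k l) 1 + min (x l k) 1) ^ 2 =
        ((min (x k l) 1) ^ 2 + 2 * (min (x k l) 1 * min (x l k) 1)) + (min (x l k) 1) ^ 2 := by
      intros
      ring
    simp only [this, sum_add_distrib]
    rw [sum_comm (f := fun k l => (min (x l k) 1) ^ 2)]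
    simp only [← mul_sum]
    ring
  have e4 : ∑ k ∈ T, ∑ l ∈ T, (max (x k l - 1) 0 + max (x l k - 1) 0) =
      2 * ∑ k ∈ T, ∑ l ∈ T, max (x k l - 1) 0 := by
    simp only [sum_add_distrib]
    rw [sum_comm (f := fun k l => max (x l k - 1) 0), two_mul]
  have e0 : ∀ (b c : ℝ) (f g h : α → α → ℝ),
      ∑ k ∈ T, ∑ l ∈ T, (b * f k l + c * g k l + 2 * h k l) =
      b * ∑ k ∈ T, ∑ l ∈ T, f k l + c * ∑ k ∈ T, ∑ l ∈ T, g k l +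
        2 * ∑ k ∈ T, ∑ l ∈ T, h k l := by
    intros
    simp only [sum_add_distrib, mul_sum]
  rw [e0] at hsum
  rw [e1] at hsum
  have e5 : #T / (4 * (#T - 1)) * (4 * (#T - 1) * ∑ k ∈ T, a k ^ 2) =
      #T * ∑ k ∈ T, a k ^ 2 := by
    field_simp
  rw [e2, e3, e4, e5] at hsum
  linarith

omit [Fintype α] in
lemma sum_cross_le (T V : Finset α) (z : α → α → ℝ) :
    ∑ k ∈ T, ∑ l ∈ T.erase k, ∑ i ∈ V, ∑ j ∈ V,
      min (max (z k j - z k i) 0) 1 * min (max (z l i - z l j) 0) 1 ≤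
    #T / 4 * ∑ k ∈ T, ∑ i ∈ V, ∑ j ∈ V, (min |z k i - z k j| 1) ^ 2 := by
  have hn : ∀ y : ℝ, 0 ≤ min (max y 0) 1 := fun y => le_min (le_max_right _ _) one_pos.le
  have h1 : ∑ k ∈ T, ∑ l ∈ T.erase k, ∑ i ∈ V, ∑ j ∈ V,
      min (max (z k j - z k i) 0) 1 * min (max (z l i - z l j) 0) 1 ≤
      ∑ k ∈ T, ∑ l ∈ T, ∑ i ∈ V, ∑ j ∈ V,
      min (max (z k j - z k i) 0) 1 * min (max (z l i - z l j) 0) 1 :=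
    sum_le_sum fun k _ => sum_le_sum_of_subset_of_nonneg (erase_subset _ _) fun l _ _ =>
      sum_nonneg fun i _ => sum_nonneg fun j _ => mul_nonneg (hn _) (hn _)
  refine h1.trans ?_
  have e1 : ∀ f : α → α → α → α → ℝ, ∑ k ∈ T, ∑ l ∈ T, ∑ i ∈ V, ∑ j ∈ V, f k l i j =
      ∑ i ∈ V, ∑ j ∈ V, ∑ k ∈ T, ∑ l ∈ T, f k l i j := by
    intro f
    calc _ = ∑ k ∈ T, ∑ i ∈ V, ∑ l ∈ T, ∑ j ∈ V, f k l i j :=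
          sum_congr rfl fun k _ => sum_comm
      _ = ∑ i ∈ V, ∑ k ∈ T, ∑ j ∈ V, ∑ l ∈ T, f k l i j := by
          rw [sum_comm]
          exact sum_congr rfl fun i _ => sum_congr rfl fun k _ => sum_comm
      _ = _ := sum_congr rfl fun i _ => sum_comm
  have e2 : ∑ k ∈ T, ∑ i ∈ V, ∑ j ∈ V, (min |z k i - z k j| 1) ^ 2 =
      ∑ i ∈ V, ∑ j ∈ V, ∑ k ∈ T, (min |z k i - z k j| 1) ^ 2 := by
    rw [sum_comm]
    exact sum_congr rfl fun i _ => sum_comm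
  rw [e1, e2, mul_sum]
  refine sum_le_sum fun i _ => ?_
  rw [mul_sum]
  refine sum_le_sum fun j _ => ?_
  rw [← sum_mul_sum]
  have h2 := sq_sum_le_card_mul_sum_sq (s := T) (f := fun k => min |z k i - z k j| 1)
  have e3 : ∑ k ∈ T, min |z k i - z k j| 1 =
      ∑ k ∈ T, min (max (z k j - z k i) 0) 1 + ∑ l ∈ T, min (max (z l i - z l j) 0) 1 := by
    rw [← sum_add_distrib]
    refine sum_congr rfl fun k _ => ?_
    rcases le_total (z k i) (z k j) with h | h
    · rw [abs_of_nonpos (by linarith), max_eq_left (by linarith), max_eq_right (by linarith)]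
      simp
    · rw [abs_of_nonneg (by linarith), max_eq_right (by linarith), max_eq_left (by linarith)]
      simp
  rw [e3] at h2
  nlinarith [sq_nonneg (∑ k ∈ T, min (max (z k j - z k i) 0) 1 -
    ∑ l ∈ T, min (max (z l i - z l j) 0) 1)]

omit [Fintype α] [DecidableEq α] in
lemma two_mul_sum_sum_min_sq (V : Finset α) (z : α → ℝ) :
    2 * ∑ i ∈ V, ∑ j ∈ V, (min (max (z j - z i) 0) 1) ^ 2 =
      ∑ i ∈ V, ∑ j ∈ V, (min |z i - z j| 1) ^ 2 := by
  rw [two_mul]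
  nth_rw 2 [sum_comm]
  simp only [← sum_add_distrib]
  refine sum_congr rfl fun i _ => sum_congr rfl fun j _ => ?_
  rcases le_total (z i) (z j) with h | h
  · rw [abs_of_nonpos (by linarith), max_eq_left (by linarith), max_eq_right (by linarith)]
    simp
  · rw [abs_of_nonneg (by linarith), max_eq_right (by linarith), max_eq_left (by linarith)]
    simp

omit [Fintype α] [DecidableEq α] in
lemma two_mul_sum_sum_max (V : Finset α) (z : α → ℝ) :
    2 * ∑ i ∈ V, ∑ j ∈ V, max (max (z j - z i) 0 - 1) 0 =
      ∑ i ∈ V, ∑ j ∈ V, max (|z i - z j| - 1) 0 := by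
  rw [two_mul]
  nth_rw 2 [sum_comm]
  simp only [← sum_add_distrib]
  refine sum_congr rfl fun i _ => sum_congr rfl fun j _ => ?_
  rcases le_total (z i) (z j) with h | h
  · rw [abs_of_nonpos (by linarith), max_eq_left (a := z j - z i) (by linarith),
      max_eq_right (a := z i - z j) (by linarith)]
    norm_num
  · rw [abs_of_nonneg (by linarith), max_eq_right (a := z j - z i) (by linarith),
      max_eq_left (a := z i - z j) (by linarith)]
    norm_num

lemma sum_mul_exch_le (ρ : Perm α) {T : Finset α} (hT : T.Nonempty) {z : α → α → ℝ}
    {w : Perm α → α → ℝ} (hw1 : ∀ σ x, w σ x ≤ 1)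
    (hz : ∀ k ∈ T, ∀ i ∈ T.image ρ, 0 < z k i) (hzs : ∀ k ∈ T, ∑ i ∈ T.image ρ, z k i = #T) :
    ∑ σ ∈ cyl ρ T, ∑ k ∈ T, ∑ l ∈ T, max (z k (σ l) - z k (σ k)) 0 *
        (if k = l then 0 else w σ k + w σ l) ≤
      #T / 2 * ∑ σ ∈ cyl ρ T, ∑ k ∈ T, w σ k ^ 2 +
      4 * #(cyl ρ T) * ∑ k ∈ T, ∑ i ∈ T.image ρ, z k i * Real.log (z k i) := by
  have hc : #(T.image ρ) = #T := card_image_of_injective _ ρ.injective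
  have hm0 : (0 : ℝ) < #T := by exact_mod_cast card_pos.2 hT
  have hent : ∀ k ∈ T, ∑ i ∈ T.image ρ, ∑ j ∈ T.image ρ,
      (3 / 4 * (min |z k i - z k j| 1) ^ 2 + max (|z k i - z k j| - 1) 0) ≤
      4 * #T * ∑ i ∈ T.image ρ, z k i * Real.log (z k i) := by
    intro k hk
    have := sum_huber_le (T.image ρ) (z k) (hz k hk) (by rw [hc]; exact hzs k hk)
    rwa [hc] at this
  rcases (Nat.succ_le_of_lt (card_pos.2 hT)).eq_or_lt with h1 | h2
  · obtain ⟨k, rfl⟩ := card_eq_one.1 h1.symm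
    have h3 := hent k (mem_singleton_self k)
    have h4 : 0 ≤ ∑ i ∈ image ρ {k}, ∑ j ∈ image ρ {k},
      (3 / 4 * (min |z k i - z k j| 1) ^ 2 + max (|z k i - z k j| - 1) 0) :=
      sum_nonneg fun i _ => sum_nonneg fun j _ =>
        add_nonneg (by positivity) (le_max_right _ _)
    have h5 : 0 ≤ ∑ i ∈ image ρ {k}, z k i * Real.log (z k i) := by
      rw [card_singleton] at h3
      norm_num at h3 h4 ⊢
      linarith
    have h6 : 0 ≤ ∑ σ ∈ cyl ρ {k}, ∑ k ∈ {k}, w σ k ^ 2 :=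
      sum_nonneg fun σ _ => sum_nonneg fun k _ => sq_nonneg _
    simp only [sum_singleton, if_true, mul_zero, sum_const_zero] at h6 ⊢
    positivity
  have hm2 : (2 : ℝ) ≤ #T := by exact_mod_cast h2
  have hm1 : (0 : ℝ) < #T - 1 := by linarith
  have hX : (0 : ℝ) < #(cyl ρ T) := by exact_mod_cast card_pos.2 ⟨ρ, self_mem_cyl ρ T⟩
  have hσ := sum_le_sum fun σ (_ : σ ∈ cyl ρ T) => sum_sum_mul_le h2
    (x := fun k l => max (z k (σ l) - z k (σ k)) 0) (a := w σ)
    (fun k => by simp) (hw1 σ)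
  refine hσ.trans ?_
  simp only [sum_add_distrib, ← mul_sum]
  have hone : ∀ f : α → α → α → ℝ, (∀ k i, f k i i = 0) →
      #T * ∑ σ ∈ cyl ρ T, ∑ k ∈ T, ∑ l ∈ T, f k (σ k) (σ l) =
        #(cyl ρ T) * ∑ k ∈ T, ∑ i ∈ T.image ρ, ∑ j ∈ T.image ρ, f k i j := by
    intro f hf
    have h := sum_pairs ρ T (fun k _ i j => f k i j) fun k _ i => hf k i
    have e : ∑ k ∈ T, ∑ l ∈ T.erase k, ∑ i ∈ T.image ρ, ∑ j ∈ T.image ρ, f k i j =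
        (#T - 1) * ∑ k ∈ T, ∑ i ∈ T.image ρ, ∑ j ∈ T.image ρ, f k i j := by
      rw [mul_sum]
      refine sum_congr rfl fun k hk => ?_
      rw [sum_const, card_erase_of_mem hk, nsmul_eq_mul, Nat.cast_sub (card_pos.2 hT),
        Nat.cast_one]
    rw [e] at h
    refine mul_left_cancel₀ hm1.ne' ?_
    linarith
  set E := ∑ k ∈ T, ∑ i ∈ T.image ρ, ∑ j ∈ T.image ρ, (min |z k i - z k j| 1) ^ 2 with hE
  set L := ∑ k ∈ T, ∑ i ∈ T.image ρ, ∑ j ∈ T.image ρ, max (|z k i - z k j| - 1) 0 with hL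
  have hsq := hone (fun k i j => (min (max (z k j - z k i) 0) 1) ^ 2) (fun k i => by simp)
  have hsq' : 2 * ∑ k ∈ T, ∑ i ∈ T.image ρ, ∑ j ∈ T.image ρ,
      (min (max (z k j - z k i) 0) 1) ^ 2 = E := by
    rw [mul_sum]
    exact sum_congr rfl fun k _ => two_mul_sum_sum_min_sq _ _
  have hli := hone (fun k i j => max (max (z k j - z k i) 0 - 1) 0) (fun k i => by simp)
  have hli' : 2 * ∑ k ∈ T, ∑ i ∈ T.image ρ, ∑ j ∈ T.image ρ,
      max (max (z k j - z k i) 0 - 1) 0 = L := by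
    rw [mul_sum]
    exact sum_congr rfl fun k _ => two_mul_sum_sum_max _ _
  have hcr := sum_pairs ρ T (fun k l i j =>
    min (max (z k j - z k i) 0) 1 * min (max (z l i - z l j) 0) 1) (fun k l i => by simp)
  have hcr' := sum_cross_le T (T.image ρ) z
  have hfin : 3 / 4 * E + L ≤ ∑ k ∈ T, 4 * #T * ∑ i ∈ T.image ρ, z k i * Real.log (z k i) := by
    refine le_trans (le_of_eq ?_) (sum_le_sum hent)
    simp only [hE, hL, sum_add_distrib, mul_sum]
  rw [← mul_sum] at hfin
  have hE0 : 0 ≤ E := sum_nonneg fun k _ => sum_nonneg fun i _ => sum_nonneg fun j _ =>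
    sq_nonneg _
  set S := ∑ k ∈ T, ∑ i ∈ T.image ρ, z k i * Real.log (z k i)
  set s₁ := ∑ σ ∈ cyl ρ T, ∑ k ∈ T, ∑ l ∈ T, (min (max (z k (σ l) - z k (σ k)) 0) 1) ^ 2
  set s₂ := ∑ σ ∈ cyl ρ T, ∑ k ∈ T, ∑ l ∈ T, min (max (z k (σ l) - z k (σ k)) 0) 1 *
    min (max (z l (σ k) - z l (σ l)) 0) 1
  set s₃ := ∑ σ ∈ cyl ρ T, ∑ k ∈ T, ∑ l ∈ T, max (max (z k (σ l) - z k (σ k)) 0 - 1) 0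
  have b1 : (#T : ℝ) * s₁ = #(cyl ρ T) * (E / 2) := by
    rw [hsq]
    congr 1
    linarith
  have b2 : (#T : ℝ) * ((#T - 1) * s₂) ≤ #(cyl ρ T) * (#T / 4 * E) := by
    rw [← mul_assoc, hcr]
    exact mul_le_mul_of_nonneg_left hcr' hX.le
  have b3 : (#T : ℝ) * s₃ = #(cyl ρ T) * (L / 2) := by
    rw [hli]
    congr 1
    linarith
  have b1' : (#T - 1) / #T * s₁ ≤ #(cyl ρ T) * (E / 2) / #T := by
    rw [← b1]
    have hs1 : 0 ≤ s₁ := sum_nonneg fun σ _ => sum_nonneg fun k _ => sum_nonneg fun l _ =>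
      sq_nonneg _
    rw [mul_div_cancel_left₀ _ hm0.ne']
    refine mul_le_of_le_one_left hs1 ?_
    rw [div_le_one hm0]
    linarith
  have b2' : (#T - 1) / #T * s₂ ≤ #(cyl ρ T) * (E / 4) / #T := by
    rw [le_div_iff₀ hm0, ← mul_le_mul_iff_right₀ hm0]
    calc _ = (#T : ℝ) * ((#T - 1) * s₂) := by field_simp
      _ ≤ _ := b2
      _ = _ := by ring
  have b3' : 2 * s₃ = #(cyl ρ T) * L / #T := by
    rw [eq_div_iff hm0.ne']
    linarith
  have b4 : (#(cyl ρ T) : ℝ) * (3 / 4 * E + L) / #T ≤ 4 * #(cyl ρ T) * S := by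
    rw [div_le_iff₀ hm0]
    calc _ ≤ (#(cyl ρ T) : ℝ) * (4 * #T * S) := mul_le_mul_of_nonneg_left hfin hX.le
      _ = _ := by ring
  have b5 : (#(cyl ρ T) : ℝ) * (3 / 4 * E + L) / #T = #(cyl ρ T) * (E / 2) / #T +
      #(cyl ρ T) * (E / 4) / #T + #(cyl ρ T) * L / #T := by ring
  rw [mul_add]
  linarith

lemma hasPlans_one_left {w : Perm α → α → ℝ} (hw1 : ∀ σ x, w σ x ≤ 1)
    {q : Perm α → ℝ} (hq : ∀ σ, 0 < q σ) : HasPlans w (1 / 2) 4 (fun _ => 1) q := by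
  intro ρ T hT
  have hm : (0 : ℝ) < #T := by exact_mod_cast card_pos.2 hT
  have hX : (0 : ℝ) < #(cyl ρ T) := by exact_mod_cast card_pos.2 ⟨ρ, self_mem_cyl ρ T⟩
  have hc : #(T.image ρ) = #T := card_image_of_injective _ ρ.injective
  have hone : ∀ σ : Perm α, (0 : ℝ) < (fun _ => 1 : Perm α → ℝ) σ := fun _ => one_pos
  have hex : ∀ k ∈ T, ∃ π : α → α → ℝ,
      (∀ i ∈ T.image ρ, ∀ j ∈ T.image ρ, 0 ≤ π i j) ∧
      (∀ i ∈ T.image ρ, ∑ j ∈ T.image ρ, π i j =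
        mass (fun _ => 1) ρ T k i / tot (fun _ => 1) ρ T) ∧
      (∀ j ∈ T.image ρ, ∑ i ∈ T.image ρ, π i j = mass q ρ T k j / tot q ρ T) ∧
      ∀ i ∈ T.image ρ, ∀ j ∈ T.image ρ, i ≠ j →
        π i j = max (margDens q ρ T k j - margDens q ρ T k i) 0 / #T ^ 2 := by
    intro k hk
    have e : ∀ i ∈ T.image ρ, ∀ j ∈ T.image ρ,
        max (margDens (fun _ => 1) ρ T k i / #T - margDens q ρ T k i / #T -
          (margDens (fun _ => 1) ρ T k j / #T - margDens q ρ T k j / #T)) 0 =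
        max (margDens q ρ T k j - margDens q ρ T k i) 0 / #T := by
      intro i hi j hj
      rw [margDens_one ρ hk hi, margDens_one ρ hk hj, ← max_div_div_right hm.le, zero_div]
      congr 1
      ring
    obtain ⟨π, h1, h2, h3, h4⟩ := exists_plan (T.image ρ)
      (fun i => margDens (fun _ => 1) ρ T k i / #T) (fun i => margDens q ρ T k i / #T)
      (by rw [← sum_div, ← sum_div, sum_margDens ρ hq hk, sum_margDens ρ hone hk])
      (by
        intro i hi
        rw [sum_congr rfl fun j hj => e i hi j hj, ← sum_div, hc,
          mul_div_cancel₀ _ hm.ne', div_le_iff₀' hm, margDens_one ρ hk hi, mul_one,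
          ← sum_margDens ρ hq hk]
        refine sum_le_sum fun j hj => max_le ?_ (margDens_pos ρ hq hk hj).le
        linarith [margDens_pos ρ hq hk hi])
    refine ⟨π, h1, fun i hi => ?_, fun j hj => ?_, fun i hi j hj hij => ?_⟩
    · rw [mass_div_tot ρ hk, h2 i hi]
    · rw [mass_div_tot ρ hk, h3 j hj]
    · rw [h4 i j hij, e i hi j hj, hc]
      ring
  choose! π h1 h2 h3 h4 using hex
  refine ⟨π, h1, h2, h3, ?_⟩
  have htot : tot (fun _ : Perm α => 1) ρ T = #(cyl ρ T) := by simp [tot]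
  have hlhs : ∑ k ∈ T, ∑ i ∈ T.image ρ, ∑ j ∈ T.image ρ,
      π k i j * ((∑ σ ∈ fib ρ T k i, 1 * exch w k i j σ) / mass (fun _ => 1) ρ T k i) =
      (∑ σ ∈ cyl ρ T, ∑ k ∈ T, ∑ l ∈ T,
        max (margDens q ρ T k (σ l) - margDens q ρ T k (σ k)) 0 *
        (if k = l then 0 else w σ k + w σ l)) / (#T * #(cyl ρ T)) := by
    rw [sum_comm (s := cyl ρ T), sum_div]
    refine sum_congr rfl fun k hk => ?_
    rw [sum_exch_eq ρ (fun _ => 1) w hk, sum_div]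
    refine sum_congr rfl fun σ hσ => ?_
    rw [one_mul, sum_div]
    refine sum_congr rfl fun l hl => ?_
    have hσk := (apply_mem_image_of_mem_cyl hσ k).2 hk
    have hσl := (apply_mem_image_of_mem_cyl hσ l).2 hl
    split_ifs with hkl
    · simp
    · rw [h4 k hk _ hσk _ hσl (fun h => hkl (σ.injective h)), mass_eq ρ hone hk, htot,
        margDens_one ρ hk hσk]
      field_simp
  rw [hlhs]
  have hmain := sum_mul_exch_le ρ hT hw1 (fun k hk i hi => margDens_pos ρ hq hk hi)
    (fun k hk => sum_margDens ρ hq hk)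
  rw [div_le_iff₀ (by positivity)]
  refine hmain.trans (le_of_eq ?_)
  have hent : ∑ k ∈ T, (margEnt (fun _ => 1) ρ T k + margEnt q ρ T k) =
      (∑ k ∈ T, ∑ i ∈ T.image ρ, margDens q ρ T k i * Real.log (margDens q ρ T k i)) / #T := by
    rw [sum_div]
    exact sum_congr rfl fun k hk => by rw [margEnt_one ρ hk, zero_add, margEnt_eq ρ hk]
  rw [hent, htot]
  simp only [one_mul]
  field_simp

end PlansOfBounded

section ConvexDistance

open Finset Equiv

variable {n : ℕ} {A : Finset (Perm (Fin n))}

/-- Probability vectors supported on `A`. -/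
def probOn (A : Finset (Perm (Fin n))) : Set (Perm (Fin n) → ℝ) :=
  {p | (∀ τ, 0 ≤ p τ) ∧ (∀ τ, τ ∉ A → p τ = 0) ∧ ∑ τ, p τ = 1}

/-- The probability that the value at `j` differs from `σ j`. -/
def disagree (p : Perm (Fin n) → ℝ) (σ : Perm (Fin n)) (j : Fin n) : ℝ :=
  ∑ τ, p τ * (if σ j ≠ τ j then (1 : ℝ) else 0)

lemma disagree_nonneg {p : Perm (Fin n) → ℝ} (hp : p ∈ probOn A) (σ : Perm (Fin n)) (j : Fin n) :
    0 ≤ disagree p σ j :=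
  sum_nonneg fun τ _ => mul_nonneg (hp.1 τ) (by split_ifs <;> norm_num)

lemma disagree_le_one {p : Perm (Fin n) → ℝ} (hp : p ∈ probOn A) (σ : Perm (Fin n))
    (j : Fin n) : disagree p σ j ≤ 1 := by
  rw [← hp.2.2]
  exact sum_le_sum fun τ _ => mul_le_of_le_one_right (hp.1 τ) (by split_ifs <;> norm_num)

lemma isCompact_probOn (A : Finset (Perm (Fin n))) : IsCompact (probOn A) := by
  have h : probOn A = stdSimplex ℝ (Perm (Fin n)) ∩ {p | ∀ τ, τ ∉ A → p τ = 0} := by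
    ext p
    simp only [probOn, stdSimplex, Set.mem_ofPred_eq, Set.mem_inter_iff]
    tauto
  rw [h]
  refine (isCompact_stdSimplex ℝ _).inter_right ?_
  simp only [Set.ofPred_forall]
  exact isClosed_iInter fun τ => isClosed_iInter fun _ =>
    isClosed_eq (continuous_apply τ) continuous_const

lemma single_mem_probOn {y : Perm (Fin n)} (hy : y ∈ A) :
    (fun τ => if τ = y then (1 : ℝ) else 0) ∈ probOn A := by
  refine ⟨fun τ => ?_, fun τ hτ => ?_, by simp⟩
  · dsimp only
    split_ifs <;> norm_num
  · have h : τ ≠ y := by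
      rintro rfl
      exact hτ hy
    exact if_neg h

lemma disagree_single (σ y : Perm (Fin n)) (j : Fin n) :
    disagree (fun τ => if τ = y then (1 : ℝ) else 0) σ j = if σ j ≠ y j then 1 else 0 := by
  simp only [disagree, ite_mul, one_mul, zero_mul, sum_ite_eq', mem_univ, if_true]

lemma sum_sq_le_sum_mul_of_min {ι : Type*} (s : Finset ι) (w v : ι → ℝ)
    (h : ∀ t : ℝ, 0 ≤ t → t ≤ 1 → ∑ j ∈ s, w j ^ 2 ≤ ∑ j ∈ s, ((1 - t) * w j + t * v j) ^ 2) :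
    ∑ j ∈ s, w j ^ 2 ≤ ∑ j ∈ s, w j * v j := by
  by_contra! hlt
  set a := ∑ j ∈ s, w j * v j - ∑ j ∈ s, w j ^ 2 with ha
  set b := ∑ j ∈ s, (v j - w j) ^ 2 with hb
  have hb0 : 0 ≤ b := sum_nonneg fun j _ => sq_nonneg _
  have ha0 : a < 0 := by linarith
  have hd : 0 < b - a := by linarith
  have hexp : ∀ t : ℝ, ∑ j ∈ s, ((1 - t) * w j + t * v j) ^ 2 =
      ∑ j ∈ s, w j ^ 2 + t * (2 * a + t * b) := by
    intro t
    rw [ha, hb, ← sum_sub_distrib, mul_sum, mul_sum, ← sum_add_distrib, mul_sum,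
      ← sum_add_distrib]
    refine sum_congr rfl fun j _ => ?_
    ring
  have ht : 0 < -a / (b - a) := div_pos (by linarith) hd
  have h1 := h (-a / (b - a)) ht.le ((div_le_one hd).2 (by linarith))
  rw [hexp] at h1
  have h2 : -a / (b - a) * b ≤ -a := by
    rw [div_mul_eq_mul_div, div_le_iff₀ hd]
    nlinarith
  nlinarith [mul_pos ht (neg_pos.2 ha0)]

lemma exists_optimal (hA : A.Nonempty) (σ : Perm (Fin n)) :
    ∃ p ∈ probOn A, fTal A σ = ∑ j, disagree p σ j ^ 2 ∧
      ∀ q ∈ probOn A, fTal A σ ≤ ∑ j, disagree p σ j * disagree q σ j := by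
  obtain ⟨y, hy⟩ := hA
  have hc : Continuous fun p : Perm (Fin n) → ℝ => ∑ j, disagree p σ j ^ 2 := by
    unfold disagree
    fun_prop
  obtain ⟨p, hp, hmin⟩ := (isCompact_probOn A).exists_isMinOn ⟨_, single_mem_probOn hy⟩
    hc.continuousOn
  have hf : fTal A σ = ∑ j, disagree p σ j ^ 2 := by
    refine IsLeast.csInf_eq ⟨⟨p, hp.1, hp.2.1, hp.2.2, rfl⟩, ?_⟩
    rintro _ ⟨q, h1, h2, h3, rfl⟩
    exact hmin (show q ∈ probOn A from ⟨h1, h2, h3⟩)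
  refine ⟨p, hp, hf, fun q hq => ?_⟩
  rw [hf]
  refine sum_sq_le_sum_mul_of_min _ _ _ fun t ht0 ht1 => ?_
  have hmix : (fun τ => (1 - t) * p τ + t * q τ) ∈ probOn A := by
    refine ⟨fun τ => ?_, fun τ hτ => ?_, ?_⟩
    · have := hp.1 τ
      have := hq.1 τ
      have : 0 ≤ 1 - t := by linarith
      positivity
    · simp [hp.2.1 τ hτ, hq.2.1 τ hτ]
    · rw [sum_add_distrib, ← mul_sum, ← mul_sum, hp.2.2, hq.2.2]
      ring
  refine (hmin hmix).trans (le_of_eq ?_)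
  refine sum_congr rfl fun j _ => ?_
  congr 1
  simp only [disagree, mul_sum, ← sum_add_distrib]
  refine sum_congr rfl fun τ _ => ?_
  ring

/-- Optimal weights for the convex distance, and the cost bounds they satisfy. -/
lemma exists_weights (hA : A.Nonempty) : ∃ w : Perm (Fin n) → Fin n → ℝ,
    (∀ σ x, 0 ≤ w σ x) ∧ (∀ σ x, w σ x ≤ 1) ∧ (∀ σ, fTal A σ = ∑ j, w σ j ^ 2) ∧
    (∀ σ, ∀ y ∈ A, fTal A σ ≤ cost w univ σ y) ∧
    (∀ σ y, 3 / 4 * fTal A σ - fTal A y ≤ cost w univ σ y) := by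
  choose P hP hf hopt using exists_optimal (A := A) hA
  refine ⟨fun σ => disagree (P σ) σ, fun σ => disagree_nonneg (hP σ) σ,
    fun σ => disagree_le_one (hP σ) σ, hf, fun σ y hy => ?_, fun σ y => ?_⟩
  · refine (hopt σ _ (single_mem_probOn hy)).trans (le_of_eq ?_)
    refine sum_congr rfl fun j _ => ?_
    rw [disagree_single]
    split_ifs <;> simp
  · have h1 := hopt σ _ (hP y)
    have h2 : ∑ j, disagree (P σ) σ j * disagree (P y) σ j ≤
        ∑ j, (1 / 4 * disagree (P σ) σ j ^ 2 + disagree (P y) y j ^ 2 +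
          if σ j ≠ y j then disagree (P σ) σ j else 0) := by
      refine sum_le_sum fun j _ => ?_
      have h0 := disagree_nonneg (hP σ) σ j
      split_ifs with h
      · nlinarith [disagree_le_one (hP y) σ j, sq_nonneg (disagree (P σ) σ j),
          sq_nonneg (disagree (P y) y j)]
      · have h3 : disagree (P y) σ j = disagree (P y) y j := by
          rw [not_not] at h
          simp only [disagree, h]
        rw [h3]
        nlinarith [sq_nonneg (1 / 2 * disagree (P σ) σ j - disagree (P y) y j)]
    rw [sum_add_distrib, sum_add_distrib, ← mul_sum, ← hf, ← hf] at h2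
    change _ ≤ _ + cost (fun σ => disagree (P σ) σ) univ σ y at h2
    linarith

lemma relEnt_one {β : Type*} {X : Finset β} (hX : X.Nonempty) : relEnt X (fun _ => 1) = 0 := by
  have : (#X : ℝ) ≠ 0 := by exact_mod_cast (card_pos.2 hX).ne'
  simp [relEnt, this]

lemma log_exp_moment_le (hA : A.Nonempty) :
    8 * Real.log ((∑ σ, Real.exp (fTal A σ / 16)) / n.factorial) ≤
      (∑ σ, fTal A σ) / n.factorial := by
  obtain ⟨w, hw, hw1, hf, h1, h2⟩ := exists_weights hA
  have hp : ∀ σ, 0 < Real.exp (fTal A σ / 16) := fun σ => Real.exp_pos _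
  have h := transport_inequality hw hp (q := fun _ => 1) (fun _ => one_pos)
    (fun _ => hasPlans_one_right hp) univ 1 1 (fun σ => 3 / 4 * fTal A σ) (fTal A)
    (fun σ _ y _ => h2 σ y)
  simp only [cyl_univ, tot, relEnt_one univ_nonempty, one_mul, ← hf] at h
  simp only [relEnt, Real.log_exp, sum_const, nsmul_eq_mul, mul_one, card_univ,
    Fintype.card_perm, Fintype.card_fin] at h
  set Z := ∑ σ, Real.exp (fTal A σ / 16)
  have e1 : ∑ σ, Real.exp (fTal A σ / 16) * (3 / 4 * fTal A σ) =
      3 / 4 * ∑ σ, Real.exp (fTal A σ / 16) * fTal A σ := by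
    rw [mul_sum]
    exact sum_congr rfl fun σ _ => by ring
  have e2 : ∑ σ, Real.exp (fTal A σ / 16) * (fTal A σ / 16) =
      1 / 16 * ∑ σ, Real.exp (fTal A σ / 16) * fTal A σ := by
    rw [mul_sum]
    exact sum_congr rfl fun σ _ => by ring
  rw [e1, e2, mul_div_assoc, mul_div_assoc] at h
  linarith

lemma sum_fTal_le (hA : A.Nonempty) :
    (∑ σ, fTal A σ) / n.factorial ≤ -8 * Real.log (#A / n.factorial) := by
  obtain ⟨w, hw, hw1, hf, h1, h2⟩ := exists_weights hA
  set q : Perm (Fin n) → ℝ := fun y => if y ∈ A then 1 else Real.exp (-n / 4) with hq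
  have hq0 : ∀ y, 0 < q y := fun y => by
    rw [hq]
    dsimp only
    split_ifs
    · exact one_pos
    · exact Real.exp_pos _
  have hn : ∀ σ, fTal A σ ≤ n := fun σ => by
    rw [hf]
    calc _ ≤ ∑ j : Fin n, (1 : ℝ) := sum_le_sum fun j _ => pow_le_one₀ (hw σ j) (hw1 σ j)
      _ = n := by simp
  have h := transport_inequality hw (p := fun _ => 1) (fun _ => one_pos) hq0
    (fun τ => hasPlans_one_left hw1 fun y => hq0 (τ * y)) univ 1 1 (fTal A)
    (fun y => if y ∈ A then 0 else n) (fun σ _ y _ => by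
      have hc : 0 ≤ cost w univ σ y := sum_nonneg fun x _ => by
        have := hw σ x
        split_ifs <;> linarith
      split_ifs with hy
      · rw [sub_zero]
        exact h1 σ y hy
      · linarith [hn σ])
  simp only [cyl_univ, tot, relEnt_one univ_nonempty, one_mul, ← hf] at h
  simp only [relEnt, sum_const, nsmul_eq_mul, mul_one, card_univ,
    Fintype.card_perm, Fintype.card_fin] at h
  have e1 : ∑ y, q y * Real.log (q y) =
      -(1 / 4) * ∑ y, q y * (if y ∈ A then 0 else (n : ℝ)) := by
    rw [mul_sum]
    refine sum_congr rfl fun y _ => ?_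
    rw [hq]
    dsimp only
    split_ifs
    · simp
    · rw [Real.log_exp]
      ring
  rw [e1, mul_div_assoc] at h
  have hA0 : (0 : ℝ) < #A := by exact_mod_cast card_pos.2 hA
  have hfac : (0 : ℝ) < n.factorial := by exact_mod_cast n.factorial_pos
  have hQ : (#A : ℝ) ≤ ∑ y, q y := by
    calc (#A : ℝ) = ∑ y ∈ A, q y := by
          rw [sum_congr rfl fun y hy => (if_pos hy : q y = 1)]
          simp
      _ ≤ _ := sum_le_sum_of_subset_of_nonneg (subset_univ _) fun y _ _ => (hq0 y).le
  have hlog : Real.log (#A / n.factorial) ≤ Real.log ((∑ y, q y) / n.factorial) :=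
    Real.log_le_log (by positivity) (by gcongr)
  linarith

end ConvexDistance

/-- Talagrand's concentration inequality on the symmetric group. -/
theorem stmt1 {n : ℕ} (hn : 2 ≤ n) (A : Finset (Equiv.Perm (Fin n))) (hA : A.Nonempty) :
    ∑ σ : Equiv.Perm (Fin n), Real.exp (fTal A σ / 16) * ((n.factorial : ℝ))⁻¹ ≤
      1 / ((A.card : ℝ) / (n.factorial : ℝ)) := by
  have h1 := log_exp_moment_le hA
  have h2 := sum_fTal_le hA
  have hA0 : (0 : ℝ) < A.card := by exact_mod_cast Finset.card_pos.2 hA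
  have hfac : (0 : ℝ) < n.factorial := by exact_mod_cast n.factorial_pos
  have hZ : 0 < ∑ σ, Real.exp (fTal A σ / 16) :=
    Finset.sum_pos (fun σ _ => Real.exp_pos _) Finset.univ_nonempty
  rw [← Finset.sum_mul, ← div_eq_mul_inv, one_div]
  refine (Real.log_le_log_iff (by positivity) (by positivity)).1 ?_
  rw [Real.log_inv]
  linarith

end
end

section
/- Every ℓ-local subgroup G of S_n admits an ℓ-local base. -/
attribute [local instance] Classical.propDecidable

noncomputable section

/-- Degree (cardinality of the support) of a permutation. -/
noncomputable def degree {n : ℕ} (σ : Equiv.Perm (Fin n)) : ℕ :=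
  (Finset.univ.filter fun i => σ i ≠ i).card

/-- The subgroup `G_j` of elements of `G` fixing every index `> j`. -/
def Gj {n : ℕ} (G : Subgroup (Equiv.Perm (Fin n))) (j : Fin n) :
    Set (Equiv.Perm (Fin n)) :=
  {σ | σ ∈ G ∧ ∀ i : Fin n, j < i → σ i = i}

/-- The orbit `O_j` of `j` under `G_j`. -/
def Orb {n : ℕ} (G : Subgroup (Equiv.Perm (Fin n))) (j : Fin n) : Set (Fin n) :=
  {i | ∃ σ ∈ Gj G j, σ j = i}

/-- An `ℓ`-local base of `G`. -/
def IsLocalBase {n : ℕ} (ℓ : ℕ) (G : Subgroup (Equiv.Perm (Fin n)))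
    (t : Fin n → Fin n → Equiv.Perm (Fin n)) : Prop :=
  ∀ j : Fin n, (j : ℕ) ≠ 0 →
    t j j = 1 ∧ ∀ i ∈ Orb G j, i ≠ j →
      t i j ∈ Gj G j ∧ t i j i = j ∧ degree (t i j) ≤ ℓ

/-- The map `U_T (i_2, …, i_n) = t_{i_2,2} t_{i_3,3} ⋯ t_{i_n,n}`. -/
noncomputable def UT {n : ℕ} (t : Fin n → Fin n → Equiv.Perm (Fin n))
    (i : Fin n → Fin n) : Equiv.Perm (Fin n) :=
  (((List.finRange n).drop 1).map fun j => t (i j) j).prod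

/-- `G` is an `ℓ`-local group of permutations. -/
def IsLLocal {n : ℕ} (ℓ : ℕ) (G : Subgroup (Equiv.Perm (Fin n))) : Prop :=
  ∀ σ ∈ G, ∀ i j : Fin n, σ i = j →
    ∃ τ ∈ G, {x | τ x ≠ x} ⊆ {x | σ x ≠ x} ∧ degree τ ≤ ℓ ∧ τ i = j

/-- Every `ℓ`-local group of permutations admits an `ℓ`-local base. -/
theorem stmt3 {n ℓ : ℕ} (hn : 2 ≤ n) (hℓ : 2 ≤ ℓ) (hℓn : ℓ ≤ n)
    (G : Subgroup (Equiv.Perm (Fin n))) (hG : IsLLocal ℓ G) :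
    ∃ t : Fin n → Fin n → Equiv.Perm (Fin n), IsLocalBase ℓ G t := by
  have key : ∀ i j : Fin n, ∃ τ : Equiv.Perm (Fin n), (i = j → τ = 1) ∧
      (i ∈ Orb G j → i ≠ j → τ ∈ Gj G j ∧ τ i = j ∧ degree τ ≤ ℓ) := by
    intro i j
    by_cases hij : i = j
    · exact ⟨1, fun _ => rfl, fun _ h => absurd hij h⟩
    by_cases hi : i ∈ Orb G j
    · obtain ⟨σ, ⟨hσ, hfix⟩, hji⟩ := hi
      obtain ⟨τ, hτ, hsupp, hdeg, hτi⟩ := hG σ⁻¹ (G.inv_mem hσ) i j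
        (Equiv.Perm.inv_eq_iff_eq.mpr hji.symm)
      refine ⟨τ, fun h => absurd h hij, fun _ _ => ⟨⟨hτ, fun k hk => ?_⟩, hτi, hdeg⟩⟩
      by_contra hne
      exact hsupp hne (Equiv.Perm.inv_eq_iff_eq.mpr (hfix k hk).symm)
    · exact ⟨1, fun h => absurd h hij, fun h => absurd h hi⟩
  choose t ht using key
  exact ⟨t, fun j _ => ⟨(ht j j).1 rfl, fun i hi hij => (ht i j).2 hi hij⟩⟩

end
end
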